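/- arXiv:2105.05174 — 4 statements merged into one kernel-verified Lean document; each statement's English description precedes it below -/
import Mathlib

section
/- For every β > 0 and for μ_d-almost every L ∈ 𝒮_d, there exists a constant C > 0 such that for every l ∈ L∖{0} with ‖l‖ ≠ 1, |Num(l)| ≥ C·|log(‖l‖)|^{1−d−β}. In particular, μ_d-almost every lattice L ∈ 𝒮_d is weakly admissible, i.e. for every r ≥ ‖L‖, inf{|Num(l)| : l ∈ L, 0 < ‖l‖ < r} > 0. -/
noncomputable section

open MeasureTheory

/-- `SL_d(ℝ)`. -/
abbrev SLR (d : ℕ) := Matrix.SpecialLinearGroup (Fin d) ℝ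

/-- `SL_d(ℤ)` viewed as a subgroup of `SL_d(ℝ)` (the range of the coefficientwise
integer-cast homomorphism `SL_d(ℤ) →* SL_d(ℝ)`). -/
def SLZ (d : ℕ) : Subgroup (SLR d) :=
  (Matrix.SpecialLinearGroup.map (n := Fin d) (Int.castRingHom ℝ)).range

instance (d : ℕ) : MeasurableSpace (Matrix (Fin d) (Fin d) ℝ) :=
  inferInstanceAs (MeasurableSpace (Fin d → Fin d → ℝ))

instance (d : ℕ) : MeasurableSpace (SLR d) :=
  inferInstanceAs (MeasurableSpace {A : Matrix (Fin d) (Fin d) ℝ // A.det = 1})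

/-- The space of unimodular lattices `𝒮_d = SL_d(ℝ)/SL_d(ℤ)`; the coset of
`g ∈ SL_d(ℝ)` corresponds to the lattice `g·ℤ^d`. -/
abbrev LatticeSpace (d : ℕ) := SLR d ⧸ SLZ d

/-- The vector `g·v ∈ ℝ^d` for `g ∈ SL_d(ℝ)` and `v ∈ ℤ^d`: a point of the
lattice `g·ℤ^d`. -/
def latVec {d : ℕ} (g : SLR d) (v : Fin d → ℤ) : EuclideanSpace ℝ (Fin d) :=
  (WithLp.equiv 2 (Fin d → ℝ)).symm (g.1.mulVec fun i => (v i : ℝ))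

/-- The minimal norm `‖L‖ = inf {‖l‖ : l ∈ L ∖ {0}}` of the lattice `L = g·ℤ^d`. -/
def gMin {d : ℕ} (g : SLR d) : ℝ :=
  sInf {r : ℝ | ∃ v : Fin d → ℤ, latVec g v ≠ 0 ∧ ‖latVec g v‖ = r}

section Auxiliary

open Set Filter Topology ENNReal

/-- Lebesgue measure on the unit interval. -/
def unitVolume : Measure ℝ := volume.restrict (Icc 0 1)

instance : IsProbabilityMeasure unitVolume := ⟨by simp [unitVolume]⟩

theorem lintegral_Icc_rpow_neg_le {s : ℝ} (hs1 : s < 1) :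
    ∫⁻ x in Icc (0 : ℝ) 1, ENNReal.ofReal |x| ^ (-s) ≤ ENNReal.ofReal (1 / (1 - s)) := by
  rw [← restrict_Ioc_eq_restrict_Icc]
  have hint : IntegrableOn (fun x : ℝ => x ^ (-s)) (Ioc 0 1) := by
    have := intervalIntegral.intervalIntegrable_rpow' (a := 0) (b := 1) (r := -s) (by linarith)
    rwa [intervalIntegrable_iff_integrableOn_Ioc_of_le zero_le_one] at this
  calc ∫⁻ x in Ioc (0 : ℝ) 1, ENNReal.ofReal |x| ^ (-s)
      = ∫⁻ x in Ioc (0 : ℝ) 1, ENNReal.ofReal (x ^ (-s)) := by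
        refine setLIntegral_congr_fun measurableSet_Ioc fun x hx => ?_
        rw [abs_of_pos hx.1, ENNReal.ofReal_rpow_of_pos hx.1]
    _ = ENNReal.ofReal (∫ x in Ioc (0 : ℝ) 1, x ^ (-s)) := by
        rw [ofReal_integral_eq_lintegral_ofReal hint]
        filter_upwards [ae_restrict_mem measurableSet_Ioc] with x hx
        exact Real.rpow_nonneg hx.1.le _
    _ ≤ ENNReal.ofReal (1 / (1 - s)) := by
        rw [← intervalIntegral.integral_of_le zero_le_one, integral_rpow (Or.inl (by linarith))]
        rw [Real.one_rpow, Real.zero_rpow (by linarith)]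
        apply le_of_eq
        congr 1
        ring

theorem lintegral_unitVolume_rpow_neg_le (a : ℝ) {s : ℝ} (hs0 : 0 < s) (hs1 : s < 1) :
    ∫⁻ t, ENNReal.ofReal |a + t| ^ (-s) ∂unitVolume ≤ ENNReal.ofReal (3 / (1 - s)) := by
  set f : ℝ → ℝ≥0∞ := fun x => ENNReal.ofReal |x| ^ (-s) with hf
  have hfm : Measurable f := by fun_prop
  have hneg : ∫⁻ x in Icc (-1 : ℝ) 0, f x = ∫⁻ x in Icc (0 : ℝ) 1, f x := by
    rw [← lintegral_indicator measurableSet_Icc, ← lintegral_indicator measurableSet_Icc,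
      ← lintegral_neg_eq_self]
    congr 1
    ext x
    have : -x ∈ Icc (-1 : ℝ) 0 ↔ x ∈ Icc (0 : ℝ) 1 := by
      simp only [mem_Icc]
      constructor <;> rintro ⟨h1, h2⟩ <;> constructor <;> linarith
    by_cases hx : x ∈ Icc (0 : ℝ) 1
    · rw [indicator_of_mem hx, indicator_of_mem (this.2 hx)]; simp [hf]
    · rw [indicator_of_notMem hx, indicator_of_notMem (fun h => hx (this.1 h))]
  have hpt : ∀ x, f x ≤ 1 + (Icc (-1 : ℝ) 1).indicator f x := by
    intro x
    by_cases hx : x ∈ Icc (-1 : ℝ) 1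
    · rw [indicator_of_mem hx]; exact le_add_self
    · rw [indicator_of_notMem hx, add_zero]
      have h1 : 1 ≤ |x| := by
        by_contra! h
        exact hx ⟨(abs_lt.1 h).1.le, (abs_lt.1 h).2.le⟩
      simp only [hf]
      rw [ENNReal.rpow_neg, ENNReal.inv_le_one]
      exact ENNReal.one_le_rpow (by simpa using h1) hs0
  have h1s : 0 < 1 - s := by linarith
  calc ∫⁻ t, f (a + t) ∂unitVolume
      ≤ ∫⁻ t, (1 + (Icc (-1 : ℝ) 1).indicator f (a + t)) ∂unitVolume :=
        lintegral_mono fun t => hpt _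
    _ = 1 + ∫⁻ t, (Icc (-1 : ℝ) 1).indicator f (a + t) ∂unitVolume := by
        rw [lintegral_add_left measurable_const]; simp
    _ ≤ 1 + ∫⁻ t, (Icc (-1 : ℝ) 1).indicator f (a + t) := by
        gcongr
        exact Measure.restrict_le_self
    _ = 1 + ∫⁻ t in Icc (-1 : ℝ) 1, f t := by
        rw [lintegral_add_left_eq_self (fun t => (Icc (-1 : ℝ) 1).indicator f t) a,
          lintegral_indicator measurableSet_Icc]
    _ ≤ 1 + ((∫⁻ t in Icc (-1 : ℝ) 0, f t) + ∫⁻ t in Icc (0 : ℝ) 1, f t) := by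
        gcongr
        rw [← Icc_union_Icc_eq_Icc (show (-1 : ℝ) ≤ 0 by norm_num) zero_le_one]
        exact lintegral_union_le _ _ _
    _ ≤ ENNReal.ofReal 1 + (ENNReal.ofReal (1 / (1 - s)) + ENNReal.ofReal (1 / (1 - s))) := by
        rw [hneg, ENNReal.ofReal_one]
        have := lintegral_Icc_rpow_neg_le hs1
        gcongr
    _ ≤ ENNReal.ofReal (3 / (1 - s)) := by
        rw [← ENNReal.ofReal_add (by positivity) (by positivity),
          ← ENNReal.ofReal_add (by positivity) (by positivity)]
        apply ENNReal.ofReal_le_ofReal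
        rw [show (3 : ℝ) / (1 - s) = 1 / (1 - s) + (1 / (1 - s) + 1 / (1 - s)) by ring]
        gcongr
        rw [le_div_iff₀ h1s]
        linarith

theorem unitVolume_abs_add_mul_lt_le (a Y : ℝ) (hY : 0 ≤ Y) {ε s : ℝ} (hε : 0 < ε) (hs0 : 0 < s)
    (hs1 : s < 1) :
    unitVolume {t | |a + t| * Y < ε} ≤ ENNReal.ofReal (2 * ε) ^ s * ENNReal.ofReal Y ^ (-s) := by
  rcases hY.eq_or_lt with rfl | hY
  · have : ENNReal.ofReal (2 * ε) ^ s ≠ 0 := by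
      simp only [ne_eq, ENNReal.rpow_eq_zero_iff, not_or, not_and_or]
      exact ⟨Or.inl (by simpa using hε), Or.inl ENNReal.ofReal_ne_top⟩
    rw [ENNReal.ofReal_zero, ENNReal.zero_rpow_of_neg (by linarith), ENNReal.mul_top this]
    exact le_top
  · have hsub : {t | |a + t| * Y < ε} ⊆ Icc (-a - ε / Y) (-a + ε / Y) := by
      intro t ht
      rw [mem_ofPred_eq, ← lt_div_iff₀ hY, abs_lt] at ht
      constructor <;> linarith [ht.1, ht.2]
    have h2 : unitVolume {t | |a + t| * Y < ε} ≤ ENNReal.ofReal (2 * ε / Y) := by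
      calc unitVolume {t | |a + t| * Y < ε} ≤ volume {t | |a + t| * Y < ε} :=
            Measure.restrict_le_self _
        _ ≤ volume (Icc (-a - ε / Y) (-a + ε / Y)) := measure_mono hsub
        _ = ENNReal.ofReal (2 * ε / Y) := by
            rw [Real.volume_Icc]; congr 1; ring
    have h1 : unitVolume {t | |a + t| * Y < ε} ≤ 1 := prob_le_one
    have h3 : unitVolume {t | |a + t| * Y < ε} ≤ ENNReal.ofReal (2 * ε / Y) ^ s := by
      rcases le_total (ENNReal.ofReal (2 * ε / Y)) 1 with h | h
      · calc _ ≤ ENNReal.ofReal (2 * ε / Y) ^ (1 : ℝ) := by simpa using h2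
          _ ≤ _ := ENNReal.rpow_le_rpow_of_exponent_ge h hs1.le
      · exact h1.trans (ENNReal.one_le_rpow h hs0)
    refine h3.trans (le_of_eq ?_)
    rw [ENNReal.ofReal_div_of_pos hY, ENNReal.div_rpow_of_nonneg _ _ hs0.le, ENNReal.rpow_neg,
      div_eq_mul_inv]

/-- Measure of a neighbourhood of the coordinate hyperplanes: Markov's inequality is applied to all
the coordinates but one. -/
theorem measure_abs_mul_prod_lt_le {ι : Type*} [Fintype ι] (S : Finset ι) (a : ℝ) (b : ι → ℝ)
    {ε s : ℝ} (hε : 0 < ε) (hs0 : 0 < s) (hs1 : s < 1) :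
    (unitVolume.prod (Measure.pi fun _ : ι => unitVolume))
      {t | |a + t.1| * ∏ i ∈ S, |b i + t.2 i| < ε} ≤
      ENNReal.ofReal ((2 * ε) ^ s * (3 / (1 - s)) ^ S.card) := by
  have hm : MeasurableSet
      {t : ℝ × (ι → ℝ) | |a + t.1| * ∏ i ∈ S, |b i + t.2 i| < ε} :=
    measurableSet_lt (by fun_prop) measurable_const
  rw [Measure.prod_apply_symm hm]
  calc ∫⁻ y, unitVolume ((fun x => (x, y)) ⁻¹'
        {t : ℝ × (ι → ℝ) | |a + t.1| * ∏ i ∈ S, |b i + t.2 i| < ε})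
          ∂(Measure.pi fun _ : ι => unitVolume)
      ≤ ∫⁻ y, ENNReal.ofReal (2 * ε) ^ s * ∏ i ∈ S, ENNReal.ofReal |b i + y i| ^ (-s)
          ∂(Measure.pi fun _ : ι => unitVolume) := by
        refine lintegral_mono fun y => ?_
        refine (unitVolume_abs_add_mul_lt_le a (∏ i ∈ S, |b i + y i|)
          (Finset.prod_nonneg fun i _ => abs_nonneg _) hε hs0 hs1).trans (le_of_eq ?_)
        rw [ENNReal.ofReal_prod_of_nonneg fun i _ => abs_nonneg _,
          ENNReal.prod_rpow_of_ne_top fun i _ => ENNReal.ofReal_ne_top]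
    _ = ENNReal.ofReal (2 * ε) ^ s *
          ∏ i ∈ S, ∫⁻ t, ENNReal.ofReal |b i + t| ^ (-s) ∂unitVolume := by
        rw [lintegral_const_mul _ (by fun_prop)]
        congr 1
        rw [ProbabilityTheory.lintegral_prod_eq_prod_lintegral_of_indepFun S
          (fun i (y : ι → ℝ) => ENNReal.ofReal |b i + y i| ^ (-s))
          (ProbabilityTheory.iIndepFun_pi (μ := fun _ : ι => unitVolume)
            (X := fun i t => ENNReal.ofReal |b i + t| ^ (-s))
            (fun i => by fun_prop)) (fun i => by fun_prop)]
        refine Finset.prod_congr rfl fun i _ => ?_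
        exact (measurePreserving_eval (fun _ : ι => unitVolume) i).lintegral_comp
          (f := fun t => ENNReal.ofReal |b i + t| ^ (-s)) (by fun_prop)
    _ ≤ ENNReal.ofReal (2 * ε) ^ s * ∏ _i ∈ S, ENNReal.ofReal (3 / (1 - s)) := by
        gcongr with i _
        exact lintegral_unitVolume_rpow_neg_le _ hs0 hs1
    _ = _ := by
        have h1s : 0 < 1 - s := by linarith
        rw [Finset.prod_const, ENNReal.ofReal_mul (p := (2 * ε) ^ s) (by positivity),
          ENNReal.ofReal_rpow_of_pos (by positivity), ENNReal.ofReal_pow (by positivity)]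

theorem two_mul_rpow_le {N d q c : ℝ} (hN : 1 ≤ N) (hd : 0 ≤ d) (hq : 0 ≤ q) (hc : 0 < c) :
    (2 * (c * (2 ^ (-(N * d)) * N ^ (-q)))) ^ (N / (N + 1)) ≤
      max (2 * c) 1 * 2 ^ (d + q) * (2 ^ (-(N * d)) * N ^ (-q)) := by
  have hN0 : 0 < N := by linarith
  set y : ℝ := 2 ^ (-(N * d)) * N ^ (-q) with hy
  have hy0 : 0 < y := by positivity
  have hs0 : 0 ≤ N / (N + 1) := by positivity
  have hs1 : N / (N + 1) ≤ 1 := by rw [div_le_one (by positivity)]; linarith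
  have hB : (2 * c) ^ (N / (N + 1)) ≤ max (2 * c) 1 := by
    calc (2 * c) ^ (N / (N + 1)) ≤ max (2 * c) 1 ^ (N / (N + 1)) :=
          Real.rpow_le_rpow (by positivity) (le_max_left _ _) hs0
      _ ≤ max (2 * c) 1 ^ (1 : ℝ) := Real.rpow_le_rpow_of_exponent_le (le_max_right _ _) hs1
      _ = _ := Real.rpow_one _
  have hN2 : N ≤ 2 ^ (N + 1) := by
    have := one_add_mul_self_le_rpow_one_add (s := 1) (by norm_num) (p := N + 1) (by linarith)
    norm_num at this
    linarith
  have hyinv : y⁻¹ ≤ 2 ^ ((N + 1) * (d + q)) := by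
    rw [hy, mul_inv, ← Real.rpow_neg (by norm_num), ← Real.rpow_neg hN0.le, neg_neg, neg_neg]
    calc (2 : ℝ) ^ (N * d) * N ^ q ≤ 2 ^ ((N + 1) * d) * (2 ^ (N + 1)) ^ q := by
          gcongr
          · norm_num
          · linarith
      _ = _ := by
          rw [← Real.rpow_mul (by norm_num), ← Real.rpow_add (by norm_num)]
          congr 1
          ring
  have hys : y ^ (N / (N + 1)) ≤ 2 ^ (d + q) * y := by
    have hexp : N / (N + 1) = 1 + -(1 / (N + 1)) := by field_simp; ring
    rw [hexp, Real.rpow_add hy0, Real.rpow_one, mul_comm]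
    gcongr
    rw [Real.rpow_neg hy0.le, ← Real.inv_rpow hy0.le]
    calc y⁻¹ ^ (1 / (N + 1)) ≤ (2 ^ ((N + 1) * (d + q))) ^ (1 / (N + 1)) := by
          gcongr
      _ = 2 ^ (d + q) := by
          rw [← Real.rpow_mul (by norm_num)]
          congr 1
          field_simp
  calc (2 * (c * y)) ^ (N / (N + 1)) = (2 * c) ^ (N / (N + 1)) * y ^ (N / (N + 1)) := by
        rw [← mul_assoc, Real.mul_rpow (by positivity) hy0.le]
    _ ≤ max (2 * c) 1 * (2 ^ (d + q) * y) := by gcongr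
    _ = _ := by ring

/-- The integer points of the box `[-R, R]^d`. -/
def intBox (d : ℕ) (R : ℝ) : Finset (Fin d → ℤ) :=
  Fintype.piFinset fun _ => Finset.Icc (-⌊R⌋) ⌊R⌋

theorem mem_intBox {d : ℕ} {R : ℝ} {v : Fin d → ℤ} (h : ∀ i, |(v i : ℝ)| ≤ R) :
    v ∈ intBox d R := by
  rw [intBox, Fintype.mem_piFinset]
  intro i
  have h1 : |v i| ≤ ⌊R⌋ := by
    rw [Int.le_floor]
    simpa using h i
  rw [Finset.mem_Icc]
  exact abs_le.1 h1

theorem card_intBox_le (d : ℕ) {R : ℝ} (hR : 0 ≤ R) :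
    ((intBox d R).card : ℝ) ≤ (2 * R + 1) ^ d := by
  have h0 : 0 ≤ ⌊R⌋ := Int.floor_nonneg.2 hR
  rw [intBox, Fintype.card_piFinset_const, Nat.cast_pow, Int.card_Icc]
  gcongr
  have h2 : ((⌊R⌋ + 1 - -⌊R⌋).toNat : ℝ) = ⌊R⌋ + 1 + ⌊R⌋ := by
    rw [← Int.cast_natCast, Int.toNat_of_nonneg (by linarith)]
    push_cast
    ring
  rw [h2]
  linarith [Int.floor_le R]

/-- The total contribution of the dyadic shells to the Borel-Cantelli sum is finite. -/
theorem tsum_card_intBox_mul_ne_top {d : ℕ} (hd : 2 ≤ d) {β K c : ℝ} (hβ : 0 < β) (hK : 1 ≤ K)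
    (hc : 0 < c) :
    ∑' m : ℕ, ((intBox d (4 * K * 2 ^ (m + 1))).card : ℝ≥0∞) *
      ENNReal.ofReal ((2 * (c * (2 ^ (-((m + 1 : ℝ) * d)) * (m + 1 : ℝ) ^ (1 - d - β)))) ^
        ((m + 1 : ℝ) / (m + 1 + 1)) * (3 / (1 - (m + 1 : ℝ) / (m + 1 + 1))) ^ (d - 2)) ≠ ⊤ := by
  set D : ℝ := (9 * K) ^ d * (max (2 * c) 1 * 2 ^ ((d : ℝ) + (d - 1 + β))) * 6 ^ (d - 2) with hD
  have hbound : ∀ m : ℕ, ((intBox d (4 * K * 2 ^ (m + 1))).card : ℝ≥0∞) *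
      ENNReal.ofReal ((2 * (c * (2 ^ (-((m + 1 : ℝ) * d)) * (m + 1 : ℝ) ^ (1 - d - β)))) ^
        ((m + 1 : ℝ) / (m + 1 + 1)) * (3 / (1 - (m + 1 : ℝ) / (m + 1 + 1))) ^ (d - 2)) ≤
      ENNReal.ofReal (D * ((m + 1 : ℕ) : ℝ) ^ (-1 - β)) := by
    intro m
    have hd' : (2 : ℝ) ≤ d := by exact_mod_cast hd
    rw [← ENNReal.ofReal_natCast, ← ENNReal.ofReal_mul (by positivity)]
    apply ENNReal.ofReal_le_ofReal
    have hcard : ((intBox d (4 * K * 2 ^ (m + 1))).card : ℝ) ≤ (9 * K * 2 ^ (m + 1)) ^ d := by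
      refine (card_intBox_le d (by positivity)).trans ?_
      gcongr
      have : (1 : ℝ) ≤ 2 ^ (m + 1) := one_le_pow₀ (by norm_num)
      nlinarith
    push_cast
    set N : ℝ := (m : ℝ) + 1 with hN
    have hN1 : 1 ≤ N := by simp [hN]
    have hN0 : 0 < N := by linarith
    have hpow := two_mul_rpow_le (N := N) (d := d) (q := d - 1 + β) (c := c) hN1 (by positivity)
      (by linarith) hc
    rw [show -((d : ℝ) - 1 + β) = 1 - d - β by ring] at hpow
    have hs : 3 / (1 - N / (N + 1)) = 3 * (N + 1) := by
      field_simp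
      ring
    have hs2 : (3 * (N + 1)) ^ (d - 2) ≤ 6 ^ (d - 2) * N ^ (d - 2) := by
      rw [← mul_pow]
      exact pow_le_pow_left₀ (by positivity) (by linarith) _
    rw [hs]
    calc ((intBox d (4 * K * 2 ^ (m + 1))).card : ℝ) *
          ((2 * (c * (2 ^ (-(N * d)) * N ^ (1 - d - β)))) ^ (N / (N + 1)) *
            (3 * (N + 1)) ^ (d - 2))
        ≤ (9 * K * 2 ^ (m + 1)) ^ d * ((max (2 * c) 1 * 2 ^ ((d : ℝ) + (d - 1 + β)) *
            (2 ^ (-(N * d)) * N ^ (1 - d - β))) * (6 ^ (d - 2) * N ^ (d - 2))) := by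
          gcongr
      _ = D * (((2 : ℝ) ^ (m + 1)) ^ d * 2 ^ (-(N * d))) *
            (N ^ (1 - d - β) * N ^ (d - 2)) := by
          rw [hD, mul_pow (9 * K)]; ring
      _ = D * N ^ (-1 - β) := by
          have e1 : ((2 : ℝ) ^ (m + 1)) ^ d * 2 ^ (-(N * d)) = 1 := by
            rw [← Real.rpow_natCast 2 (m + 1), ← Real.rpow_natCast _ d,
              ← Real.rpow_mul (by norm_num), ← Real.rpow_add (by norm_num), hN]
            push_cast
            rw [add_neg_cancel, Real.rpow_zero]
          have e2 : N ^ (1 - d - β) * N ^ (d - 2) = N ^ (-1 - β) := by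
            rw [← Real.rpow_natCast N (d - 2), ← Real.rpow_add hN0, Nat.cast_sub hd]
            congr 1
            push_cast
            ring
          rw [e1, e2, mul_one]
  refine ne_top_of_le_ne_top ?_ (ENNReal.tsum_le_tsum hbound)
  refine Summable.tsum_ofReal_ne_top ?_
  refine Summable.mul_left _ ?_
  exact (summable_nat_add_iff 1).2 (Real.summable_nat_rpow.2 (by linarith))

section Shear

variable {d : ℕ}

@[fun_prop]
theorem continuous_latVec_apply (v : Fin d → ℤ) (i : Fin d) :
    Continuous fun g : SLR d => latVec g v i := by
  change Continuous fun g : SLR d => g.1.mulVec (fun k => (v k : ℝ)) i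
  simp only [Matrix.mulVec, dotProduct]
  refine continuous_finsetSum _ fun k _ => Continuous.mul ?_ continuous_const
  exact (continuous_subtype_val
    (p := fun A : Matrix (Fin d) (Fin d) ℝ => A.det = 1)).matrix_elem i k

theorem exists_abs_le_mul_of_latVec_le (g : SLR d) :
    ∃ K : ℝ, 1 ≤ K ∧ ∀ (v : Fin d → ℤ) (R : ℝ), (∀ k, |latVec g v k| ≤ R) →
      ∀ i, |(v i : ℝ)| ≤ K * R := by
  obtain ⟨A, hA⟩ : ∃ A : Matrix (Fin d) (Fin d) ℝ, A * g.1 = 1 :=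
    ⟨(g⁻¹).1, by
      rw [← Matrix.SpecialLinearGroup.coe_mul, inv_mul_cancel, Matrix.SpecialLinearGroup.coe_one]⟩
  refine ⟨1 + ∑ i, ∑ k, |A i k|, ?_, fun v R hR i => ?_⟩
  · have : 0 ≤ ∑ i, ∑ k, |A i k| :=
      Finset.sum_nonneg fun i _ => Finset.sum_nonneg fun k _ => abs_nonneg _
    linarith
  · have hR0 : 0 ≤ R := (abs_nonneg _).trans (hR i)
    have hv : (v i : ℝ) = ∑ k, A i k * latVec g v k := by
      have h1 : A.mulVec (g.1.mulVec fun k => (v k : ℝ)) = fun k => (v k : ℝ) := by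
        rw [Matrix.mulVec_mulVec, hA, Matrix.one_mulVec]
      exact (congrFun h1 i).symm
    rw [hv]
    calc |∑ k, A i k * latVec g v k| ≤ ∑ k, |A i k * latVec g v k| :=
          Finset.abs_sum_le_sum_abs _ _
      _ ≤ ∑ k, |A i k| * R := by
          gcongr with k _
          rw [abs_mul]
          gcongr
          exact hR k
      _ = (∑ k, |A i k|) * R := by rw [Finset.sum_mul]
      _ ≤ (1 + ∑ i, ∑ k, |A i k|) * R := by
          gcongr
          have := Finset.single_le_sum (f := fun i => ∑ k, |A i k|)
            (fun i _ => Finset.sum_nonneg fun k _ => abs_nonneg _) (Finset.mem_univ i)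
          linarith

/-- The unipotent matrix adding `u i` times the `j`-th coordinate to the `i`-th one, `i ≠ j`. -/
def shear (j : Fin d) (u : Fin d → ℝ) : SLR d :=
  ⟨1 + Matrix.replicateCol Unit (Function.update u j 0) *
      Matrix.replicateRow Unit (Pi.single j (1 : ℝ)), by
    rw [Matrix.det_one_add_replicateCol_mul_replicateRow]
    simp⟩

theorem latVec_shear_mul (j : Fin d) (u : Fin d → ℝ) (g : SLR d) (v : Fin d → ℤ) (i : Fin d) :
    latVec (shear j u * g) v i = latVec g v i + Function.update u j 0 i * latVec g v j := by
  change (shear j u * g).1.mulVec (fun k => (v k : ℝ)) i =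
    g.1.mulVec (fun k => (v k : ℝ)) i + Function.update u j 0 i * g.1.mulVec (fun k => (v k : ℝ)) j
  rw [Matrix.SpecialLinearGroup.coe_mul, ← Matrix.mulVec_mulVec]
  generalize g.1.mulVec (fun k => (v k : ℝ)) = w
  change (1 + Matrix.replicateCol Unit (Function.update u j 0) *
      Matrix.replicateRow Unit (Pi.single j (1 : ℝ))).mulVec w i = _
  rw [Matrix.add_mulVec, Matrix.one_mulVec, Pi.add_apply]
  congr 1
  simp [Matrix.mulVec, dotProduct, Matrix.mul_apply, Pi.single_apply]

theorem continuous_shear (j : Fin d) : Continuous (shear j : (Fin d → ℝ) → SLR d) := by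
  refine Continuous.subtype_mk ?_ _
  refine continuous_const.add (Continuous.matrix_mul (Continuous.matrix_replicateCol ?_)
    continuous_const)
  exact continuous_id.update j continuous_const

/-- The shear with coefficients `t.2`, except for the `i`-th one which is `t.1`. -/
def shearAt (j i : Fin d) (t : ℝ × (Fin d → ℝ)) : SLR d :=
  shear j (Function.update t.2 i t.1)

@[fun_prop]
theorem continuous_shearAt (j i : Fin d) : Continuous (shearAt j i) :=
  (continuous_shear j).comp (continuous_snd.update i continuous_fst)

/-- The law of the parameters of a random shear. -/
def shearMeasure (d : ℕ) : Measure (ℝ × (Fin d → ℝ)) :=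
  unitVolume.prod (Measure.pi fun _ : Fin d => unitVolume)

instance : IsProbabilityMeasure (shearMeasure d) := by
  unfold shearMeasure; infer_instance

theorem latVec_shearAt_mul_self (j i : Fin d) (t : ℝ × (Fin d → ℝ)) (g : SLR d)
    (v : Fin d → ℤ) : latVec (shearAt j i t * g) v j = latVec g v j := by
  simp [shearAt, latVec_shear_mul]

theorem abs_prod_latVec_shearAt_mul {j i : Fin d} (hij : i ≠ j) (t : ℝ × (Fin d → ℝ)) (g : SLR d)
    (v : Fin d → ℤ) (hv : latVec g v j ≠ 0) :
    |∏ k, latVec (shearAt j i t * g) v k| = |latVec g v j| ^ d *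
      (|latVec g v i / latVec g v j + t.1| *
        ∏ k ∈ (Finset.univ.erase j).erase i, |latVec g v k / latVec g v j + t.2 k|) := by
  have hk : ∀ k ∈ Finset.univ.erase j, latVec (shearAt j i t * g) v k =
      latVec g v j * (latVec g v k / latVec g v j + Function.update t.2 i t.1 k) := by
    intro k hk
    rw [shearAt, latVec_shear_mul, Function.update_of_ne (Finset.ne_of_mem_erase hk)]
    field_simp
  have hi : i ∈ Finset.univ.erase j := by simp [hij]
  have hpow : |latVec g v j| ^ d = |latVec g v j| * |latVec g v j| ^ (d - 1) := by
    rw [← pow_succ', Nat.sub_add_cancel j.pos]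
  rw [Finset.abs_prod, ← Finset.mul_prod_erase _ _ (Finset.mem_univ j), latVec_shearAt_mul_self,
    Finset.prod_congr rfl (fun k hk' => by rw [hk k hk', abs_mul]), Finset.prod_mul_distrib,
    Finset.prod_const, Finset.card_erase_of_mem (Finset.mem_univ j), Finset.card_univ,
    Fintype.card_fin, ← Finset.mul_prod_erase _ _ hi, Function.update_self, hpow, mul_assoc]
  congr 3
  refine Finset.prod_congr rfl fun k hk' => ?_
  rw [Function.update_of_ne (Finset.ne_of_mem_erase hk')]

end Shear

section Generic

variable {d : ℕ}

instance : BorelSpace (Matrix (Fin d) (Fin d) ℝ) :=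
  inferInstanceAs (BorelSpace (Fin d → Fin d → ℝ))

instance : BorelSpace (SLR d) :=
  inferInstanceAs (BorelSpace {A : Matrix (Fin d) (Fin d) ℝ // A.det = 1})

instance : PolishSpace (SLR d) :=
  have : PolishSpace (Matrix (Fin d) (Fin d) ℝ) :=
    inferInstanceAs (PolishSpace (Fin d → Fin d → ℝ))
  Matrix.SpecialLinearGroup.isClosedEmbedding_val.polishSpace

instance : IsClosed (SLZ d : Set (SLR d)) := by
  rw [SLZ, MonoidHom.coe_range]
  exact (Topology.IsClosedEmbedding.specialLinearGroup_map
    (f := Int.castRingHom ℝ) Int.isClosedEmbedding_coe_real).isClosed_range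

instance : Countable (SLZ d) := by
  have : Countable (Matrix (Fin d) (Fin d) ℤ) :=
    inferInstanceAs (Countable (Fin d → Fin d → ℤ))
  have : Countable (Matrix.SpecialLinearGroup (Fin d) ℤ) :=
    inferInstanceAs (Countable {A : Matrix (Fin d) (Fin d) ℤ // A.det = 1})
  exact Set.countable_coe_iff.2 (Set.countable_range _)

instance : BorelSpace (LatticeSpace d) :=
  ⟨QuotientGroup.continuous_mk.map_eq_borel QuotientGroup.mk_surjective⟩

/-- The vector of parameter `v` in the lattice `g·ℤ^d` has its largest coordinate at `j` and its
`Num` is exceptionally small. -/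
def IsExceptional (β : ℝ) (j : Fin d) (g : SLR d) (v : Fin d → ℤ) : Prop :=
  (∀ k, |latVec g v k| ≤ |latVec g v j|) ∧ 3 ≤ |latVec g v j| ∧
    |∏ k, latVec g v k| < Real.log |latVec g v j| ^ ((1 : ℝ) - d - β)

/-- There are finitely many exceptional vectors with largest coordinate at `j`, and no vector
outside the hyperplane `x_j = 0` has a vanishing coordinate. -/
def IsGeneric (β : ℝ) (j : Fin d) (g : SLR d) : Prop :=
  (∃ F : Finset (Fin d → ℤ), ∀ v, v ∉ F → ¬ IsExceptional β j g v) ∧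
    ∀ v, latVec g v j ≠ 0 → ∏ k, latVec g v k ≠ 0

theorem measurable_latVec_apply (v : Fin d → ℤ) (k : Fin d) :
    Measurable fun g : SLR d => latVec g v k :=
  (continuous_latVec_apply v k).measurable

theorem measurableSet_isExceptional (β : ℝ) (j : Fin d) (v : Fin d → ℤ) :
    MeasurableSet {g : SLR d | IsExceptional β j g v} := by
  have hm := measurable_latVec_apply (d := d) v
  have h : {g : SLR d | IsExceptional β j g v} =
      (⋂ k, {g : SLR d | |latVec g v k| ≤ |latVec g v j|}) ∩
        ({g : SLR d | 3 ≤ |latVec g v j|} ∩ {g : SLR d | |∏ k, latVec g v k| <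
          Real.log |latVec g v j| ^ ((1 : ℝ) - d - β)}) := by
    ext g
    simp [IsExceptional]
  rw [h]
  exact (MeasurableSet.iInter fun k => measurableSet_le (by fun_prop) (by fun_prop)).inter
    ((measurableSet_le (by fun_prop) (by fun_prop)).inter
      (measurableSet_lt (by fun_prop) (by fun_prop)))

theorem measurableSet_isGeneric (β : ℝ) (j : Fin d) :
    MeasurableSet {g : SLR d | IsGeneric β j g} := by
  have hm := measurable_latVec_apply (d := d)
  have h : {g : SLR d | IsGeneric β j g} =
      (⋃ F : Finset (Fin d → ℤ), ⋂ v, ⋂ (_ : v ∉ F), {g : SLR d | IsExceptional β j g v}ᶜ) ∩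
        ⋂ v, ({g : SLR d | latVec g v j = 0} ∪ {g : SLR d | ∏ k, latVec g v k = 0}ᶜ) := by
    ext g
    simp only [IsGeneric, mem_ofPred_eq, mem_inter_iff, mem_iUnion, mem_iInter, mem_union,
      mem_compl_iff]
    exact and_congr Iff.rfl (forall_congr' fun v => by tauto)
  rw [h]
  exact (MeasurableSet.iUnion fun F => MeasurableSet.iInter fun v => MeasurableSet.iInter fun _ =>
      (measurableSet_isExceptional β j v).compl).inter
    (MeasurableSet.iInter fun v => (measurableSet_eq_fun (by fun_prop) measurable_const).union
      (measurableSet_eq_fun (by fun_prop) measurable_const).compl)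

theorem ae_shearMeasure_mem_Icc :
    ∀ᵐ t ∂shearMeasure d, t.1 ∈ Icc (0 : ℝ) 1 ∧ ∀ k, t.2 k ∈ Icc (0 : ℝ) 1 := by
  have h : ∀ᵐ x ∂unitVolume, x ∈ Icc (0 : ℝ) 1 := ae_restrict_mem measurableSet_Icc
  have h2 : ∀ᵐ y ∂(Measure.pi fun _ : Fin d => unitVolume), ∀ k, y k ∈ Icc (0 : ℝ) 1 :=
    ae_all_iff.2 fun k =>
      (measurePreserving_eval (fun _ : Fin d => unitVolume) k).quasiMeasurePreserving.ae h
  exact (Measure.quasiMeasurePreserving_fst.ae h).and (Measure.quasiMeasurePreserving_snd.ae h2)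

theorem ae_prod_latVec_shearAt_mul_ne_zero {j i : Fin d} (hij : i ≠ j) (g : SLR d) :
    ∀ᵐ t ∂shearMeasure d, ∀ v, latVec (shearAt j i t * g) v j ≠ 0 →
      ∏ k, latVec (shearAt j i t * g) v k ≠ 0 := by
  refine ae_all_iff.2 fun v => ?_
  have hne : ∀ a : ℝ, ∀ᵐ x ∂unitVolume, a + x ≠ 0 := fun a => by
    refine ae_restrict_of_ae ?_
    filter_upwards [Measure.ae_ne volume (-a)] with x hx h
    exact hx (by linarith)
  have h1 : ∀ᵐ t ∂shearMeasure d, latVec g v i / latVec g v j + t.1 ≠ 0 :=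
    Measure.quasiMeasurePreserving_fst.ae (hne _)
  have h2 : ∀ᵐ t ∂shearMeasure d, ∀ k, latVec g v k / latVec g v j + t.2 k ≠ 0 := by
    have : ∀ᵐ y ∂(Measure.pi fun _ : Fin d => unitVolume),
        ∀ k, latVec g v k / latVec g v j + y k ≠ 0 :=
      ae_all_iff.2 fun k => (measurePreserving_eval (fun _ : Fin d => unitVolume)
        k).quasiMeasurePreserving.ae (hne (latVec g v k / latVec g v j))
    exact Measure.quasiMeasurePreserving_snd.ae this
  filter_upwards [h1, h2] with t ht1 ht2 hv
  rw [latVec_shearAt_mul_self] at hv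
  rw [← abs_ne_zero, abs_prod_latVec_shearAt_mul hij t g v hv]
  exact mul_ne_zero (pow_ne_zero _ (abs_ne_zero.2 hv)) (mul_ne_zero (abs_ne_zero.2 ht1)
    (Finset.prod_ne_zero_iff.2 fun k _ => abs_ne_zero.2 (ht2 k)))

theorem shearMeasure_isExceptional_le {β : ℝ} (hβ : 0 < β) {j i : Fin d} (hij : i ≠ j) (g : SLR d)
    (v : Fin d → ℤ) (m : ℕ) (hv : 2 ^ (m + 1) ≤ |latVec g v j|) :
    shearMeasure d {t | IsExceptional β j (shearAt j i t * g) v} ≤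
      ENNReal.ofReal ((2 * (Real.log 2 ^ ((1 : ℝ) - d - β) *
        (2 ^ (-((m + 1 : ℝ) * d)) * (m + 1 : ℝ) ^ (1 - d - β)))) ^
        ((m + 1 : ℝ) / (m + 1 + 1)) * (3 / (1 - (m + 1 : ℝ) / (m + 1 + 1))) ^ (d - 2)) := by
  have hcard : ((Finset.univ.erase j).erase i).card = d - 2 := by
    rw [Finset.card_erase_of_mem (by simp [hij]), Finset.card_erase_of_mem (Finset.mem_univ j),
      Finset.card_univ, Fintype.card_fin, Nat.sub_sub]
  have hlog : 0 < Real.log 2 := Real.log_pos (by norm_num)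
  have hw0 : 0 < |latVec g v j| := lt_of_lt_of_le (by positivity) hv
  have hd : (1 : ℝ) ≤ d := by exact_mod_cast j.pos
  rw [← hcard]
  refine le_trans (measure_mono ?_) (measure_abs_mul_prod_lt_le _ (latVec g v i / latVec g v j)
    (fun k => latVec g v k / latVec g v j) (by positivity) (by positivity)
    (by rw [div_lt_one (by positivity)]; linarith))
  rintro t ⟨-, h3, hlt⟩
  rw [abs_prod_latVec_shearAt_mul hij t g v (abs_pos.1 hw0), latVec_shearAt_mul_self] at hlt
  set P := |latVec g v i / latVec g v j + t.1| *
        ∏ k ∈ (Finset.univ.erase j).erase i, |latVec g v k / latVec g v j + t.2 k| with hP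
  change P < _
  have hP0 : 0 ≤ P := mul_nonneg (abs_nonneg _) (Finset.prod_nonneg fun _ _ => abs_nonneg _)
  have hlogle : (m + 1 : ℝ) * Real.log 2 ≤ Real.log |latVec g v j| := by
    have := Real.log_le_log (by positivity) hv
    rw [Real.log_pow] at this
    exact_mod_cast this
  have h1 : Real.log |latVec g v j| ^ ((1 : ℝ) - d - β) ≤
      Real.log 2 ^ ((1 : ℝ) - d - β) * (m + 1 : ℝ) ^ ((1 : ℝ) - d - β) := by
    rw [← Real.mul_rpow hlog.le (by positivity), mul_comm (Real.log 2)]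
    exact Real.rpow_le_rpow_of_nonpos (by positivity) hlogle (by linarith)
  have h2 : ((2 : ℝ) ^ (m + 1)) ^ d * P ≤ |latVec g v j| ^ d * P := by gcongr
  have h4 : (2 : ℝ) ^ (-((m + 1 : ℝ) * d)) = (((2 : ℝ) ^ (m + 1)) ^ d)⁻¹ := by
    rw [Real.rpow_neg (by norm_num), ← pow_mul, ← Real.rpow_natCast]
    push_cast
    rfl
  rw [h4]
  have h5 := (h2.trans_lt hlt).trans_le h1
  rw [mul_comm, ← lt_div_iff₀ (by positivity)] at h5
  refine h5.trans_le (le_of_eq ?_)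
  rw [div_eq_mul_inv]
  ring

theorem ae_finite_isExceptional (hd : 2 ≤ d) {β : ℝ} (hβ : 0 < β) {j i : Fin d} (hij : i ≠ j)
    (g : SLR d) :
    ∀ᵐ t ∂shearMeasure d, {v | IsExceptional β j (shearAt j i t * g) v}.Finite := by
  obtain ⟨K, hK1, hK⟩ := exists_abs_le_mul_of_latVec_le g
  set E : (Fin d → ℤ) → Set (ℝ × (Fin d → ℝ)) := fun v =>
    {t | (t.1 ∈ Icc (0 : ℝ) 1 ∧ ∀ k, t.2 k ∈ Icc (0 : ℝ) 1) ∧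
      IsExceptional β j (shearAt j i t * g) v} with hE
  set p : ℕ → ℝ≥0∞ := fun m => ENNReal.ofReal ((2 * (Real.log 2 ^ ((1 : ℝ) - d - β) *
        (2 ^ (-((m + 1 : ℝ) * d)) * (m + 1 : ℝ) ^ (1 - d - β)))) ^
        ((m + 1 : ℝ) / (m + 1 + 1)) * (3 / (1 - (m + 1 : ℝ) / (m + 1 + 1))) ^ (d - 2)) with hp
  have hEle : ∀ v, shearMeasure d (E v) ≤
      ∑' m : ℕ, if v ∈ intBox d (4 * K * 2 ^ (m + 1)) then p m else 0 := by
    intro v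
    rcases (E v).eq_empty_or_nonempty with he | ⟨t, ⟨ht1, ht2⟩, hmax, h3, -⟩
    · simp [he]
    rw [latVec_shearAt_mul_self] at h3
    obtain ⟨n, hn1, hn2⟩ := exists_nat_pow_near (x := |latVec g v j|) (y := (2 : ℝ))
      (by linarith) (by norm_num)
    obtain ⟨m, rfl⟩ : ∃ m, n = m + 1 := by
      refine Nat.exists_eq_succ_of_ne_zero ?_
      rintro rfl
      norm_num at hn2
      linarith
    have hmem : v ∈ intBox d (4 * K * 2 ^ (m + 1)) := by
      have hle : ∀ k, |latVec g v k| ≤ 4 * 2 ^ (m + 1) := by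
        intro k
        have hu : |Function.update (Function.update t.2 i t.1) j 0 k| ≤ 1 := by
          rcases eq_or_ne k j with rfl | hkj
          · simp
          · rw [Function.update_of_ne hkj]
            rcases eq_or_ne k i with rfl | hki
            · rw [Function.update_self, abs_of_nonneg ht1.1]; exact ht1.2
            · rw [Function.update_of_ne hki, abs_of_nonneg (ht2 k).1]; exact (ht2 k).2
        have hk := hmax k
        rw [latVec_shearAt_mul_self, shearAt, latVec_shear_mul] at hk
        have h4 : |latVec g v k| ≤ |latVec g v j| + 1 * |latVec g v j| := by
          calc |latVec g v k| = |(latVec g v k +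
                Function.update (Function.update t.2 i t.1) j 0 k * latVec g v j) -
                Function.update (Function.update t.2 i t.1) j 0 k * latVec g v j| := by
                rw [add_sub_cancel_right]
            _ ≤ _ := abs_sub _ _
            _ ≤ _ := by
                rw [abs_mul]
                gcongr
        have : (2 : ℝ) ^ (m + 1 + 1) = 2 * 2 ^ (m + 1) := by ring
        linarith
      refine mem_intBox fun k => (hK v _ hle k).trans (le_of_eq (by ring))
    calc shearMeasure d (E v) ≤ shearMeasure d {t | IsExceptional β j (shearAt j i t * g) v} :=
          measure_mono fun t ht => ht.2
      _ ≤ p m := shearMeasure_isExceptional_le hβ hij g v m hn1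
      _ = if v ∈ intBox d (4 * K * 2 ^ (m + 1)) then p m else 0 := by rw [if_pos hmem]
      _ ≤ _ := ENNReal.le_tsum (f := fun m : ℕ =>
          if v ∈ intBox d (4 * K * 2 ^ (m + 1)) then p m else 0) m
  have hsum : ∑' v, shearMeasure d (E v) ≠ ⊤ := by
    refine ne_top_of_le_ne_top ?_ (ENNReal.tsum_le_tsum hEle)
    rw [ENNReal.tsum_comm]
    convert tsum_card_intBox_mul_ne_top hd hβ hK1
      (Real.rpow_pos_of_pos (Real.log_pos one_lt_two) ((1 : ℝ) - d - β)) using 3 with m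
    rw [tsum_eq_sum (s := intBox d (4 * K * 2 ^ (m + 1))) fun v hv => if_neg hv,
      Finset.sum_congr rfl fun v hv => if_pos hv, Finset.sum_const, nsmul_eq_mul]
  filter_upwards [ae_finite_setOfPred_mem hsum, ae_shearMeasure_mem_Icc] with t ht hcube
  exact ht.subset fun v hv => ⟨hcube, hv⟩

theorem ae_isGeneric_shearAt_mul (hd : 2 ≤ d) {β : ℝ} (hβ : 0 < β) {j i : Fin d} (hij : i ≠ j)
    (g : SLR d) : ∀ᵐ t ∂shearMeasure d, IsGeneric β j (shearAt j i t * g) := by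
  filter_upwards [ae_finite_isExceptional hd hβ hij g, ae_prod_latVec_shearAt_mul_ne_zero hij g]
    with t h1 h2
  exact ⟨⟨h1.toFinset, fun v hv hb => hv (h1.mem_toFinset.2 hb)⟩, h2⟩

end Generic

section Lattice

variable {d : ℕ}

/-- The set of lattices all of whose bases are generic. -/
def genericSet (β : ℝ) (j : Fin d) : Set (LatticeSpace d) :=
  {x | ∀ g : SLR d, QuotientGroup.mk g = x → IsGeneric β j g}

theorem mk_mem_genericSet {β : ℝ} {j : Fin d} {g : SLR d} :
    (QuotientGroup.mk g : LatticeSpace d) ∈ genericSet β j ↔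
      ∀ γ : SLZ d, IsGeneric β j (g * γ) := by
  refine ⟨fun h γ => h _ (QuotientGroup.eq.2 (by simp)), fun h g' hg' => ?_⟩
  have := h ⟨g⁻¹ * g', QuotientGroup.eq.1 hg'.symm⟩
  rwa [mul_inv_cancel_left] at this

theorem measurableSet_genericSet (β : ℝ) (j : Fin d) :
    MeasurableSet (genericSet β j : Set (LatticeSpace d)) := by
  have h : (QuotientGroup.mk : SLR d → LatticeSpace d) ⁻¹' genericSet β j =
      ⋂ γ : SLZ d, (fun g => g * (γ : SLR d)) ⁻¹' {g | IsGeneric β j g} := by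
    ext g
    rw [mem_preimage, mk_mem_genericSet, mem_iInter]
    rfl
  refine measurableSet_quotient.2 ?_
  change MeasurableSet ((QuotientGroup.mk : SLR d → LatticeSpace d) ⁻¹' genericSet β j)
  rw [h]
  exact MeasurableSet.iInter fun γ =>
    (continuous_mul_const (γ : SLR d)).measurable (measurableSet_isGeneric β j)

theorem ae_shearAt_smul_mem_genericSet (hd : 2 ≤ d) {β : ℝ} (hβ : 0 < β) {j i : Fin d}
    (hij : i ≠ j) (x : LatticeSpace d) :
    ∀ᵐ t ∂shearMeasure d, shearAt j i t • x ∈ genericSet β j := by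
  obtain ⟨g, rfl⟩ := QuotientGroup.mk_surjective x
  filter_upwards [ae_all_iff.2 fun γ : SLZ d => ae_isGeneric_shearAt_mul hd hβ hij (g * γ)]
    with t ht
  refine mk_mem_genericSet.2 fun γ => ?_
  change IsGeneric β j (shearAt j i t * g * γ)
  rw [mul_assoc]
  exact ht γ

theorem ae_mem_genericSet (hd : 2 ≤ d) {μ : Measure (LatticeSpace d)} [IsProbabilityMeasure μ]
    (hinv : ∀ (g : SLR d) (s : Set (LatticeSpace d)), μ ((g • ·) ⁻¹' s) = μ s) {β : ℝ}
    (hβ : 0 < β) (j : Fin d) : ∀ᵐ x ∂μ, x ∈ genericSet β j := by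
  obtain ⟨i, hij⟩ : ∃ i : Fin d, i ≠ j :=
    have : Nontrivial (Fin d) := Fin.nontrivial_iff_two_le.2 hd
    exists_ne j
  have hm : Measurable fun p : LatticeSpace d × (ℝ × (Fin d → ℝ)) => shearAt j i p.2 • p.1 :=
    Continuous.measurable (by fun_prop)
  have h : ∀ᵐ t ∂shearMeasure d, ∀ᵐ x ∂μ, shearAt j i t • x ∈ genericSet β j :=
    (Measure.ae_ae_comm (p := fun x t => shearAt j i t • x ∈ genericSet β j)
      (hm (measurableSet_genericSet β j))).1
      (Eventually.of_forall fun x => ae_shearAt_smul_mem_genericSet hd hβ hij x)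
  obtain ⟨t, ht⟩ := h.exists
  rw [ae_iff] at ht ⊢
  rw [← ht]
  exact (hinv (shearAt j i t) {x | x ∉ genericSet β j}).symm

theorem finite_norm_latVec_lt (g : SLR d) (r : ℝ) : {v | ‖latVec g v‖ < r}.Finite := by
  obtain ⟨K, -, hK⟩ := exists_abs_le_mul_of_latVec_le g
  refine (intBox d (K * r)).finite_toSet.subset fun v hv => mem_intBox (hK v r fun k => ?_)
  exact (PiLp.norm_apply_le (latVec g v) k).trans (le_of_lt hv)

theorem Set.Finite.exists_pos_forall_le {α : Type*} {s : Set α} (hs : s.Finite) (f : α → ℝ)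
    (hf : ∀ a ∈ s, 0 < f a) : ∃ c > 0, ∀ a ∈ s, c ≤ f a := by
  rcases s.eq_empty_or_nonempty with rfl | hne
  · exact ⟨1, one_pos, by simp⟩
  · obtain ⟨a, ha, hmin⟩ := hs.exists_minimalFor f s hne
    exact ⟨f a, hf a ha, fun b hb => le_of_not_gt fun h => absurd (hmin hb h.le) (not_le.2 h)⟩

theorem exists_forall_abs_le_of_ne_zero {w : EuclideanSpace ℝ (Fin d)} (hw : w ≠ 0) :
    ∃ j, w j ≠ 0 ∧ ∀ k, |w k| ≤ |w j| := by
  obtain ⟨k, hk⟩ : ∃ k, w k ≠ 0 := by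
    by_contra! h
    exact hw (PiLp.ext h)
  have : Nonempty (Fin d) := ⟨k⟩
  obtain ⟨j, hj⟩ := Finite.exists_max fun k => |w k|
  exact ⟨j, abs_pos.1 ((abs_pos.2 hk).trans_le (hj k)), hj⟩

theorem norm_le_card_mul {w : EuclideanSpace ℝ (Fin d)} {R : ℝ} (h : ∀ k, |w k| ≤ R) :
    ‖w‖ ≤ d * R := by
  rcases d.eq_zero_or_pos with rfl | hd
  · simp [Subsingleton.elim w 0]
  have hR : 0 ≤ R := (abs_nonneg _).trans (h ⟨0, hd⟩)
  have hd : (1 : ℝ) ≤ d := by exact_mod_cast hd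
  rw [EuclideanSpace.norm_eq]
  refine Real.sqrt_le_iff.2 ⟨by positivity, ?_⟩
  calc ∑ k, ‖w k‖ ^ 2 ≤ ∑ _k : Fin d, R ^ 2 := by
        gcongr with k _
        exact h k
    _ = d * R ^ 2 := by simp
    _ ≤ (d * R) ^ 2 := by
        rw [mul_pow]
        gcongr
        nlinarith

theorem prod_ne_zero_of_isGeneric {β : ℝ} {g : SLR d} (hg : ∀ j, IsGeneric β j g) {v : Fin d → ℤ}
    (hv : latVec g v ≠ 0) : ∏ k, latVec g v k ≠ 0 := by
  obtain ⟨j, hj, -⟩ := exists_forall_abs_le_of_ne_zero hv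
  exact (hg j).2 v hj

theorem exists_le_abs_prod_of_norm_lt {β : ℝ} {g : SLR d} (hg : ∀ j, IsGeneric β j g) (r : ℝ) :
    ∃ c > (0 : ℝ), ∀ v : Fin d → ℤ,
      latVec g v ≠ 0 → ‖latVec g v‖ < r → c ≤ |∏ i, latVec g v i| := by
  obtain ⟨c, hc, h⟩ := Set.Finite.exists_pos_forall_le
    ((finite_norm_latVec_lt g r).subset
      (Set.inter_subset_right (s := {v | latVec g v ≠ 0})))
    (fun v => |∏ i, latVec g v i|) fun v hv => abs_pos.2 (prod_ne_zero_of_isGeneric hg hv.1)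
  exact ⟨c, hc, fun v hv hr => h v ⟨hv, hr⟩⟩

theorem exists_mul_abs_log_rpow_le_abs_prod {β : ℝ} (hβ : 0 < β) {g : SLR d}
    (hg : ∀ j, IsGeneric β j g) :
    ∃ C > (0 : ℝ), ∀ v : Fin d → ℤ, latVec g v ≠ 0 → ‖latVec g v‖ ≠ 1 →
      C * |Real.log ‖latVec g v‖| ^ ((1 : ℝ) - d - β) ≤ |∏ i, latVec g v i| := by
  choose F hF using fun j => (hg j).1
  have hlog : ∀ v, latVec g v ≠ 0 → ‖latVec g v‖ ≠ 1 →
      0 < |Real.log ‖latVec g v‖| ^ ((1 : ℝ) - d - β) := fun v h0 h1 =>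
    Real.rpow_pos_of_pos (abs_pos.2 (Real.log_ne_zero_of_pos_of_ne_one (norm_pos_iff.2 h0) h1)) _
  obtain ⟨c, hc, h⟩ := Set.Finite.exists_pos_forall_le
    (((finite_norm_latVec_lt g (d * 3)).union
      (finite_iUnion fun j => (F j).finite_toSet)).subset
      (Set.inter_subset_right (s := {v | latVec g v ≠ 0 ∧ ‖latVec g v‖ ≠ 1})))
    (fun v => |∏ i, latVec g v i| / |Real.log ‖latVec g v‖| ^ ((1 : ℝ) - d - β))
    fun v hv => div_pos (abs_pos.2 (prod_ne_zero_of_isGeneric hg hv.1.1)) (hlog v hv.1.1 hv.1.2)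
  refine ⟨min c 1, by positivity, fun v h0 h1 => ?_⟩
  by_cases hS : v ∈ {v | ‖latVec g v‖ < d * 3} ∪ ⋃ j, (F j : Set (Fin d → ℤ))
  · rw [← le_div_iff₀ (hlog v h0 h1)]
    exact (min_le_left _ _).trans (h v ⟨⟨h0, h1⟩, hS⟩)
  · simp only [mem_union, mem_ofPred_eq, mem_iUnion, Finset.mem_coe, not_or, not_lt,
      not_exists] at hS
    obtain ⟨j, -, hmax⟩ := exists_forall_abs_le_of_ne_zero h0
    have hd : (1 : ℝ) ≤ d := by exact_mod_cast j.pos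
    have h3 : 3 ≤ |latVec g v j| :=
      le_of_mul_le_mul_left (hS.1.trans (norm_le_card_mul hmax)) (by linarith)
    have hle : |latVec g v j| ≤ ‖latVec g v‖ := PiLp.norm_apply_le (latVec g v) j
    have hlogj : 0 < Real.log |latVec g v j| := Real.log_pos (by linarith)
    have hlogle : Real.log |latVec g v j| ≤ |Real.log ‖latVec g v‖| :=
      (Real.log_le_log (by linarith) hle).trans (le_abs_self _)
    have hprod : Real.log |latVec g v j| ^ ((1 : ℝ) - d - β) ≤ |∏ i, latVec g v i| :=
      le_of_not_gt fun hlt => hF j v (hS.2 j) ⟨hmax, h3, hlt⟩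
    calc min c 1 * |Real.log ‖latVec g v‖| ^ ((1 : ℝ) - d - β)
        ≤ 1 * |Real.log ‖latVec g v‖| ^ ((1 : ℝ) - d - β) :=
          mul_le_mul_of_nonneg_right (min_le_right _ _) (hlog v h0 h1).le
      _ ≤ Real.log |latVec g v j| ^ ((1 : ℝ) - d - β) := by
          rw [one_mul]
          exact Real.rpow_le_rpow_of_nonpos hlogj hlogle (by linarith)
      _ ≤ _ := hprod

end Lattice

end Auxiliary

/-- For every `β > 0` and `μ_d`-almost every unimodular lattice `L ∈ 𝒮_d` (with respect
to any `SL_d(ℝ)`-invariant Borel probability measure): there is `C > 0` such that every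
`l ∈ L ∖ {0}` with `‖l‖ ≠ 1` satisfies `|Num(l)| ≥ C·|log ‖l‖|^{1−d−β}`; in particular
`L` is weakly admissible: for every `r ≥ ‖L‖`,
`inf {|Num(l)| : l ∈ L, 0 < ‖l‖ < r} > 0`. -/
theorem stmt10 (d : ℕ) (hd : 2 ≤ d)
    (μ : Measure (LatticeSpace d)) [IsProbabilityMeasure μ]
    (hinv : ∀ (g : SLR d) (s : Set (LatticeSpace d)), μ ((g • ·) ⁻¹' s) = μ s)
    (β : ℝ) (hβ : 0 < β) :
    ∀ᵐ x ∂μ, ∃ g : SLR d, QuotientGroup.mk g = x ∧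
      ((∃ C > (0 : ℝ), ∀ v : Fin d → ℤ, latVec g v ≠ 0 → ‖latVec g v‖ ≠ 1 →
          C * |Real.log ‖latVec g v‖| ^ ((1 : ℝ) - d - β) ≤ |∏ i, latVec g v i|) ∧
        ∀ r : ℝ, gMin g ≤ r → ∃ c > (0 : ℝ), ∀ v : Fin d → ℤ,
          latVec g v ≠ 0 → ‖latVec g v‖ < r → c ≤ |∏ i, latVec g v i|) := by
  filter_upwards [ae_all_iff.2 (ae_mem_genericSet hd hinv hβ)] with x hx
  obtain ⟨g, rfl⟩ := QuotientGroup.mk_surjective x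
  have hg : ∀ j, IsGeneric β j g := fun j => hx j g rfl
  exact ⟨g, rfl, exists_mul_abs_log_rpow_le_abs_prod hβ hg,
    fun r _ => exists_le_abs_prod_of_norm_lt hg r⟩
end
end

section
/- Let β > 0, C > 0, ε > 0 and let L be a lattice in ℝ² of covolume 1 such that ‖L‖ ≥ √ε and such that for every l = (l₁,l₂) ∈ L∖{0} with ‖l‖ ≠ 1, |l₁·l₂| ≥ C·|log(‖l‖)|^{−1−β}. Then there exists D > 0 (depending only on C, β, ε) and T₀ > 0 such that for every T ≥ T₀ and every integer i with −log(T) ≤ i ≤ T + log(T), one has ‖δ_i L‖² ≥ D·T^{−1−β}. -/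
noncomputable section

/-- The minimal norm of the nonzero vectors of a set `L` in a normed group:
`‖L‖ = inf {‖x‖ : x ∈ L ∖ {0}}`. -/
def setMinNorm {E : Type*} [NormedAddCommGroup E] (L : Set E) : ℝ :=
  sInf {r : ℝ | ∃ x ∈ L, x ≠ 0 ∧ ‖x‖ = r}

/-- The lattice `A·ℤ² ⊆ ℝ²` associated to a matrix `A`. -/
def lat2 (A : Matrix (Fin 2) (Fin 2) ℝ) : Set (EuclideanSpace ℝ (Fin 2)) :=
  {x | ∃ v : Fin 2 → ℤ, x = (WithLp.equiv 2 (Fin 2 → ℝ)).symm (A.mulVec fun i => (v i : ℝ))}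

/-- The diagonal flow `δ_t = diag(e^t, e^{−t})` acting on `ℝ²`. -/
def diag2 (t : ℝ) (x : EuclideanSpace ℝ (Fin 2)) : EuclideanSpace ℝ (Fin 2) :=
  (WithLp.equiv 2 (Fin 2 → ℝ)).symm ![Real.exp t * x 0, Real.exp (-t) * x 1]

lemma setMinNorm_le_norm {E : Type*} [NormedAddCommGroup E] {L : Set E} {x : E}
    (hx : x ∈ L) (h0 : x ≠ 0) : setMinNorm L ≤ ‖x‖ := by
  refine csInf_le ⟨0, ?_⟩ ⟨x, hx, h0, rfl⟩
  rintro _ ⟨y, -, -, rfl⟩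
  exact norm_nonneg y

lemma exists_ne_zero_of_setMinNorm_pos {E : Type*} [NormedAddCommGroup E] {L : Set E}
    (h : 0 < setMinNorm L) : ∃ x ∈ L, x ≠ 0 := by
  by_contra! hL
  have he : {r : ℝ | ∃ x ∈ L, x ≠ 0 ∧ ‖x‖ = r} = ∅ := by
    ext r
    simp only [Set.mem_ofPred_eq, Set.mem_empty_iff_false, iff_false]
    rintro ⟨x, hx, h0, -⟩
    exact h0 (hL x hx)
  simp [setMinNorm, he] at h

lemma le_setMinNorm_sq {E : Type*} [NormedAddCommGroup E] {L : Set E} {d : ℝ}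
    (hne : ∃ x ∈ L, x ≠ 0) (h : ∀ x ∈ L, x ≠ 0 → d ≤ ‖x‖ ^ 2) : d ≤ setMinNorm L ^ 2 := by
  refine (Real.sqrt_le_iff.1 ?_).2
  obtain ⟨x, hx, h0⟩ := hne
  refine le_csInf ⟨_, x, hx, h0, rfl⟩ ?_
  rintro _ ⟨y, hy, hy0, rfl⟩
  exact Real.sqrt_le_iff.2 ⟨norm_nonneg y, h y hy hy0⟩

lemma two_smul_mem_lat2 {A : Matrix (Fin 2) (Fin 2) ℝ} {l : EuclideanSpace ℝ (Fin 2)}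
    (hl : l ∈ lat2 A) : (2 : ℝ) • l ∈ lat2 A := by
  obtain ⟨v, rfl⟩ := hl
  refine ⟨fun i => 2 * v i, ?_⟩
  ext i
  fin_cases i <;> simp <;> ring

lemma norm_sq_diag2 (t : ℝ) (x : EuclideanSpace ℝ (Fin 2)) :
    ‖diag2 t x‖ ^ 2 = (Real.exp t * x 0) ^ 2 + (Real.exp (-t) * x 1) ^ 2 := by
  simp [EuclideanSpace.norm_sq_eq, diag2, Fin.sum_univ_two, mul_pow]

lemma diag2_zero (t : ℝ) : diag2 t 0 = 0 := by
  ext i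
  fin_cases i <;> simp [diag2]

lemma two_mul_abs_le_norm_sq_diag2 (t : ℝ) (x : EuclideanSpace ℝ (Fin 2)) :
    2 * |x 0 * x 1| ≤ ‖diag2 t x‖ ^ 2 := by
  have h : x 0 * x 1 = (Real.exp t * x 0) * (Real.exp (-t) * x 1) := by
    have := Real.exp_add t (-t)
    rw [add_neg_cancel, Real.exp_zero] at this
    linear_combination (x 0 * x 1) * this
  rw [norm_sq_diag2, h, abs_mul]
  have := sq_nonneg (|Real.exp t * x 0| - |Real.exp (-t) * x 1|)
  rw [← sq_abs (Real.exp t * x 0), ← sq_abs (Real.exp (-t) * x 1)]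
  linarith

lemma exp_neg_mul_norm_le_norm_diag2 {t s : ℝ} (h : |t| ≤ s) (x : EuclideanSpace ℝ (Fin 2)) :
    Real.exp (-s) * ‖x‖ ≤ ‖diag2 t x‖ := by
  refine le_of_sq_le_sq ?_ (norm_nonneg _)
  obtain ⟨h1, h2⟩ := abs_le.1 h
  rw [norm_sq_diag2, mul_pow, EuclideanSpace.norm_sq_eq, Fin.sum_univ_two, mul_add]
  simp only [Real.norm_eq_abs, sq_abs, mul_pow]
  gcongr

lemma mul_rpow_le_of_abs_log_le {β C T u p : ℝ} (hβ : 0 < β) (hC : 0 < C) (hu : 0 < u)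
    (hu1 : u ≠ 1) (hT : |Real.log u| ≤ 2 * T) (h : C * |Real.log u| ^ (-(1 : ℝ) - β) ≤ p) :
    C * 2 ^ (-(1 : ℝ) - β) * T ^ (-(1 : ℝ) - β) ≤ p := by
  have hpos : 0 < |Real.log u| := abs_pos.2 (Real.log_ne_zero_of_pos_of_ne_one hu hu1)
  have hT0 : 0 ≤ T := by linarith
  refine le_trans ?_ h
  rw [mul_assoc, ← Real.mul_rpow (by norm_num) hT0]
  exact mul_le_mul_of_nonneg_left
    (Real.rpow_le_rpow_of_nonpos hpos hT (by linarith)) hC.le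

/-- Let `β, C, ε > 0`. There is `D > 0` (depending only on `β`, `C`, `ε`) such that for
every covolume-one lattice `L = A·ℤ² ⊆ ℝ²` with `‖L‖ ≥ √ε` and such that every
`l ∈ L ∖ {0}` with `‖l‖ ≠ 1` satisfies `|l₁·l₂| ≥ C·|log ‖l‖|^{−1−β}`, there is `T₀ > 0`
such that for all `T ≥ T₀` and all integers `i` with `−log T ≤ i ≤ T + log T`,
`‖δ_i L‖² ≥ D·T^{−1−β}`. -/
theorem stmt11 (β C ε : ℝ) (hβ : 0 < β) (hC : 0 < C) (hε : 0 < ε) :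
    ∃ D > (0 : ℝ), ∀ A : Matrix (Fin 2) (Fin 2) ℝ, |A.det| = 1 →
      Real.sqrt ε ≤ setMinNorm (lat2 A) →
      (∀ l ∈ lat2 A, l ≠ 0 → ‖l‖ ≠ 1 →
        C * |Real.log ‖l‖| ^ (-(1 : ℝ) - β) ≤ |l 0 * l 1|) →
      ∃ T₀ > (0 : ℝ), ∀ T : ℝ, T₀ ≤ T → ∀ i : ℤ,
        -Real.log T ≤ (i : ℝ) → (i : ℝ) ≤ T + Real.log T →
        D * T ^ (-(1 : ℝ) - β) ≤ setMinNorm (diag2 (i : ℝ) '' lat2 A) ^ 2 := by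
  refine ⟨min 1 (C / 2 * 2 ^ (-(1 : ℝ) - β)), by positivity, ?_⟩
  intro A _ hmin hL
  have hsqrt : 0 < Real.sqrt ε := Real.sqrt_pos.2 hε
  refine ⟨max 1 |Real.log (Real.sqrt ε)|, by positivity, ?_⟩
  intro T hT i hi1 hi2
  have hT1 : 1 ≤ T := (le_max_left _ _).trans hT
  have hTε : |Real.log (Real.sqrt ε)| ≤ T := (le_max_right _ _).trans hT
  have hlogT : Real.log T ≤ T := (Real.log_le_sub_one_of_pos (by linarith)).trans (by linarith)
  have hi : |(i : ℝ)| ≤ 2 * T := abs_le.2 ⟨by linarith, by linarith⟩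
  have hTpos : 0 < T ^ (-(1 : ℝ) - β) := by positivity
  have hTle : T ^ (-(1 : ℝ) - β) ≤ 1 := Real.rpow_le_one_of_one_le_of_nonpos hT1 (by linarith)
  have hpow2 : (0 : ℝ) < 2 ^ (-(1 : ℝ) - β) := by positivity
  refine le_setMinNorm_sq ?_ ?_
  · obtain ⟨x, hx, hx0⟩ := exists_ne_zero_of_setMinNorm_pos (hsqrt.trans_le hmin)
    refine ⟨_, ⟨x, hx, rfl⟩, fun h => hx0 (norm_le_zero_iff.1 ?_)⟩
    have := exp_neg_mul_norm_le_norm_diag2 hi x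
    rw [h, norm_zero] at this
    exact nonpos_of_mul_nonpos_right this (Real.exp_pos _)
  rintro _ ⟨l, hl, rfl⟩ hne
  have hl0 : l ≠ 0 := by
    rintro rfl
    exact hne (diag2_zero _)
  have hlpos : 0 < ‖l‖ := norm_pos_iff.2 hl0
  rcases lt_or_ge (2 * T) (Real.log ‖l‖) with hlarge | hsmall
  · have h1 : 1 ≤ ‖diag2 i l‖ := by
      refine le_trans ?_ (exp_neg_mul_norm_le_norm_diag2 hi l)
      rw [← Real.exp_log hlpos, ← Real.exp_add]
      exact Real.one_le_exp (by linarith)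
    calc _ ≤ 1 * (1 : ℝ) := by gcongr; exact min_le_left _ _
      _ ≤ _ := by nlinarith
  · refine le_trans ?_ (two_mul_abs_le_norm_sq_diag2 i l)
    refine (mul_le_mul_of_nonneg_right (min_le_right _ _) hTpos.le).trans ?_
    by_cases h1 : ‖l‖ = 1
    · have hn : ‖(2 : ℝ) • l‖ = 2 := by rw [norm_smul, h1]; norm_num
      have h := hL _ (two_smul_mem_lat2 hl) (smul_ne_zero two_ne_zero hl0) (by rw [hn]; norm_num)
      rw [hn] at h
      have hlog : |Real.log 2| ≤ 2 * T := by
        rw [abs_of_nonneg (Real.log_nonneg (by norm_num))]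
        linarith [Real.log_two_lt_d9]
      have h' := mul_rpow_le_of_abs_log_le hβ hC two_pos (by norm_num) hlog h
      have h4 : |((2 : ℝ) • l) 0 * ((2 : ℝ) • l) 1| = 4 * |l 0 * l 1| := by
        rw [PiLp.smul_apply, PiLp.smul_apply, smul_eq_mul, smul_eq_mul, mul_mul_mul_comm, abs_mul]
        norm_num
      linarith
    · have hge : Real.sqrt ε ≤ ‖l‖ := hmin.trans (setMinNorm_le_norm hl hl0)
      have hlog : |Real.log ‖l‖| ≤ 2 * T := by
        refine abs_le.2 ⟨?_, hsmall⟩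
        linarith [Real.log_le_log hsqrt hge, (abs_le.1 hTε).1]
      have h' := mul_rpow_le_of_abs_log_le hβ hC hlpos h1 hlog (hL l hl hl0 h1)
      have := mul_pos (mul_pos hC hpow2) hTpos
      linarith
end
end

section
/- Fix d ≥ 2. For all ε₁ > 0, β > 0 and D > 0, there exist M > 0 and t₀ > 0 such that for every t ≥ t₀, ∫_{E(t)} 1/|l₁·l₂·⋯·l_d| dl₁⋯dl_d ≤ M·(log t)^d, where E(t) = {l = (l₁,…,l_d) ∈ ℝ^d : 1 < ‖l‖ ≤ t^{1+ε₁} and |l₁·⋯·l_d| ≥ D·|log(‖l‖)|^{1−d−β}} and ‖·‖ is the Euclidean norm. -/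
noncomputable section

open MeasureTheory

/-- The function `x ↦ 1/x` truncated to the interval `[δ, T]`. -/
def truncatedInv (δ T : ℝ) : ℝ → ℝ := (Set.Icc δ T).indicator fun x => x⁻¹

lemma measurable_truncatedInv (δ T : ℝ) : Measurable (truncatedInv δ T) :=
  measurable_inv.indicator measurableSet_Icc

lemma truncatedInv_nonneg {δ : ℝ} (hδ : 0 < δ) (T x : ℝ) : 0 ≤ truncatedInv δ T x :=
  Set.indicator_nonneg (fun _ hy => inv_nonneg.2 (hδ.le.trans hy.1)) x

lemma integrable_truncatedInv_abs {δ : ℝ} (hδ : 0 < δ) (T : ℝ) :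
    Integrable fun x => truncatedInv δ T |x| := by
  have hclosed : IsClosed ((fun x : ℝ => |x|) ⁻¹' Set.Icc δ T) :=
    isClosed_Icc.preimage continuous_abs
  have hcompact : IsCompact ((fun x : ℝ => |x|) ⁻¹' Set.Icc δ T) :=
    isCompact_Icc.of_isClosed_subset hclosed fun x hx => abs_le.1 hx.2
  have hcont : ContinuousOn (fun x : ℝ => |x|⁻¹) ((fun x : ℝ => |x|) ⁻¹' Set.Icc δ T) :=
    continuous_abs.continuousOn.inv₀ fun x hx => (hδ.trans_le hx.1).ne'
  exact (integrable_indicator_iff hclosed.measurableSet).2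
    (hcont.integrableOn_compact hcompact)

lemma integral_truncatedInv_abs_le {δ T K : ℝ} (hδ : 0 < δ) (hT : 0 < T) (hK : 0 ≤ K)
    (h : Real.log (T / δ) ≤ K) : ∫ x, truncatedInv δ T |x| ≤ 2 * K := by
  have hsub : Set.Icc δ T ⊆ Set.Ioi 0 := fun x hx => hδ.trans_le hx.1
  rw [integral_comp_abs, truncatedInv, setIntegral_indicator measurableSet_Icc,
    Set.inter_eq_self_of_subset_right hsub]
  gcongr
  rcases le_or_gt δ T with hle | hlt
  · rw [integral_Icc_eq_integral_Ioc, ← intervalIntegral.integral_of_le hle,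
      integral_inv_of_pos hδ hT]
    exact h
  · simpa [Set.Icc_eq_empty_of_lt hlt] using hK

/-- If every coordinate is at most `T` in absolute value, a lower bound on the product of the
coordinates gives a lower bound on each of them. -/
lemma div_pow_le_abs_of_le_abs_prod {d : ℕ} {x : Fin d → ℝ} {T η : ℝ} (hT : 0 < T)
    (hx : ∀ i, |x i| ≤ T) (hη : η ≤ |∏ i, x i|) (i : Fin d) : η / T ^ (d - 1) ≤ |x i| := by
  rw [div_le_iff₀ (pow_pos hT _)]
  refine hη.trans ?_
  rw [Finset.abs_prod, ← Finset.mul_prod_erase _ _ (Finset.mem_univ i)]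
  gcongr
  calc ∏ j ∈ Finset.univ.erase i, |x j| ≤ ∏ _j ∈ Finset.univ.erase i, T :=
        Finset.prod_le_prod (fun _ _ => abs_nonneg _) fun j _ => hx j
    _ = T ^ (d - 1) := by simp

/-- The integral of `1/|l₁⋯l_d|` over a region where all `|lᵢ|` lie in `[δ, T]`. -/
lemma setLIntegral_inv_abs_prod_le {d : ℕ} {δ T K : ℝ} (hδ : 0 < δ) (hT : 0 < T) (hK : 0 ≤ K)
    (h : Real.log (T / δ) ≤ K) {s : Set (EuclideanSpace ℝ (Fin d))}
    (hs : ∀ l ∈ s, ∀ i, |l i| ∈ Set.Icc δ T) :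
    ∫⁻ l in s, ENNReal.ofReal (|∏ i, l i|⁻¹) ≤ ENNReal.ofReal ((2 * K) ^ d) := by
  have hmeas : Measurable fun x : Fin d → ℝ =>
      ENNReal.ofReal (∏ i, truncatedInv δ T |x i|) := by
    have := measurable_truncatedInv δ T
    fun_prop
  have hint : Integrable fun x : Fin d → ℝ => ∏ i, truncatedInv δ T |x i| :=
    Integrable.fintype_prod fun _ => integrable_truncatedInv_abs hδ T
  calc ∫⁻ l in s, ENNReal.ofReal (|∏ i, l i|⁻¹)
      ≤ ∫⁻ l in s, ENNReal.ofReal (∏ i, truncatedInv δ T |l i|) := by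
        refine setLIntegral_mono
          (hmeas.comp (PiLp.volume_preserving_ofLp (Fin d)).measurable) fun l hl => ?_
        refine ENNReal.ofReal_le_ofReal (le_of_eq ?_)
        rw [Finset.abs_prod, ← Finset.prod_inv_distrib]
        exact Finset.prod_congr rfl fun i _ => (Set.indicator_of_mem (hs l hl i) _).symm
    _ ≤ ∫⁻ l : EuclideanSpace ℝ (Fin d), ENNReal.ofReal (∏ i, truncatedInv δ T |l i|) :=
        setLIntegral_le_lintegral _ _
    _ = ∫⁻ x : Fin d → ℝ, ENNReal.ofReal (∏ i, truncatedInv δ T |x i|) :=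
        (PiLp.volume_preserving_ofLp (Fin d)).lintegral_comp hmeas
    _ = ENNReal.ofReal (∫ x : Fin d → ℝ, ∏ i, truncatedInv δ T |x i|) :=
        (ofReal_integral_eq_lintegral_ofReal hint <| Filter.Eventually.of_forall fun x =>
          Finset.prod_nonneg fun i _ => truncatedInv_nonneg hδ T _).symm
    _ ≤ ENNReal.ofReal ((2 * K) ^ d) := by
        refine ENNReal.ofReal_le_ofReal ?_
        rw [integral_fintype_prod_volume_eq_prod fun (_ : Fin d) x => truncatedInv δ T |x|,
          Finset.prod_const, Finset.card_univ, Fintype.card_fin]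
        exact pow_le_pow_left₀ (integral_nonneg fun x => truncatedInv_nonneg hδ T _)
          (integral_truncatedInv_abs_le hδ hT hK h) d

/-- For `d ≥ 2` and all `ε₁, β, D > 0` there are `M > 0` and `t₀ > 0` such that for all
`t ≥ t₀`, the integral of `1/|l₁⋯l_d|` over the region
`{l ∈ ℝ^d : 1 < ‖l‖ ≤ t^{1+ε₁}, |l₁⋯l_d| ≥ D·|log ‖l‖|^{1−d−β}}` is at most
`M·(log t)^d`. -/
theorem stmt12 (d : ℕ) (hd : 2 ≤ d) (ε₁ β D : ℝ)
    (hε₁ : 0 < ε₁) (hβ : 0 < β) (hD : 0 < D) :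
    ∃ M > (0 : ℝ), ∃ t₀ > (0 : ℝ), ∀ t : ℝ, t₀ ≤ t →
      (∫⁻ l in {l : EuclideanSpace ℝ (Fin d) |
            1 < ‖l‖ ∧ ‖l‖ ≤ t ^ ((1 : ℝ) + ε₁) ∧
            D * |Real.log ‖l‖| ^ ((1 : ℝ) - d - β) ≤ |∏ i, l i|},
          ENNReal.ofReal (|∏ i, l i|⁻¹))
        ≤ ENNReal.ofReal (M * Real.log t ^ d) := by
  have hd' : (2 : ℝ) ≤ d := by exact_mod_cast hd
  set C : ℝ := (d + |Real.log D| + (d - 1 + β)) * (1 + ε₁) with hC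
  have hCpos : 0 < C := by
    have := abs_nonneg (Real.log D)
    exact mul_pos (by linarith) (by linarith)
  refine ⟨(2 * C) ^ d, by positivity, Real.exp 1, Real.exp_pos 1, fun t ht => ?_⟩
  have htpos : 0 < t := (Real.exp_pos 1).trans_le ht
  have hL : 1 ≤ Real.log t := (Real.le_log_iff_exp_le htpos).2 ht
  set T : ℝ := t ^ ((1 : ℝ) + ε₁) with hTdef
  have hT : 0 < T := Real.rpow_pos_of_pos htpos _
  have hlogT : Real.log T = (1 + ε₁) * Real.log t := Real.log_rpow htpos _
  have hlogT1 : 1 ≤ Real.log T := by rw [hlogT]; nlinarith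
  have hlogT0 : 0 < Real.log T := by linarith
  set η : ℝ := D * Real.log T ^ ((1 : ℝ) - d - β) with hη
  have hηpos : 0 < η := mul_pos hD (Real.rpow_pos_of_pos hlogT0 _)
  have hδ : 0 < η / T ^ (d - 1) := by positivity
  have hlogη : Real.log η = Real.log D + (1 - d - β) * Real.log (Real.log T) := by
    rw [hη, Real.log_mul hD.ne' (Real.rpow_pos_of_pos hlogT0 _).ne', Real.log_rpow hlogT0]
  have hbound : Real.log (T / (η / T ^ (d - 1))) ≤ C * Real.log t := by
    rw [Real.log_div hT.ne' hδ.ne', Real.log_div hηpos.ne' (pow_pos hT _).ne', Real.log_pow,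
      hlogη, Nat.cast_sub (by omega), Nat.cast_one, hC, mul_assoc, ← hlogT]
    have h₁ : Real.log (Real.log T) ≤ Real.log T := Real.log_le_self hlogT0.le
    have h₂ : (d - 1 + β) * Real.log (Real.log T) ≤ (d - 1 + β) * Real.log T :=
      mul_le_mul_of_nonneg_left h₁ (by linarith)
    have h₃ : -Real.log D ≤ |Real.log D| * Real.log T :=
      (neg_le_abs _).trans (le_mul_of_one_le_right (abs_nonneg _) hlogT1)
    linarith
  rw [← mul_pow, mul_assoc]
  refine setLIntegral_inv_abs_prod_le hδ hT (by positivity) hbound ?_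
  rintro l ⟨hl₁, hlT, hl⟩ i
  have hcoord : ∀ j, |l j| ≤ T := fun j => (PiLp.norm_apply_le l j).trans hlT
  refine ⟨div_pow_le_abs_of_le_abs_prod hT hcoord (le_trans ?_ hl) i, hcoord i⟩
  have hlog : 0 < Real.log ‖l‖ := Real.log_pos hl₁
  rw [hη, abs_of_pos hlog]
  exact mul_le_mul_of_nonneg_left (Real.rpow_le_rpow_of_nonpos hlog
    (Real.log_le_log (by linarith) hlT) (by linarith)) hD.le
end
end

section
/- Fix d ≥ 2. For every ε₁ > 0 there exists M > 0 such that for every ε > 0 there exists t₀ > 0 such that for every t ≥ t₀, ∫_{E(t,ε)} 1/(l₁²·l₂²·⋯·l_d²) dl₁⋯dl_d ≤ M·(log t)^{2d−2}·ε, where E(t,ε) = {l = (l₁,…,l_d) ∈ ℝ^d : 1 ≤ ‖l‖ ≤ t^{1+ε₁} and |l₁·⋯·l_d| ≥ 1/(ε·(log t)^{d−1})} and ‖·‖ is the Euclidean norm. -/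
noncomputable section

open MeasureTheory

/-- The integral of an even function over a symmetric set is at most twice its integral over the
positive half. -/
lemma setLIntegral_abs_mem_le_of_even {f : ℝ → ENNReal} (hf : ∀ x, f (-x) = f x) (S : Set ℝ) :
    ∫⁻ x in {x : ℝ | |x| ∈ S}, f x ≤ 2 * ∫⁻ x in S, f x := by
  have hsub : {x : ℝ | |x| ∈ S} ⊆ S ∪ (fun x => -x) ⁻¹' S := by
    intro x hx
    rcases abs_choice x with h | h
    · left; simpa [h] using hx
    · right; simpa [h] using hx
  have hneg : ∫⁻ x in (fun x : ℝ => -x) ⁻¹' S, f x = ∫⁻ x in S, f x := by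
    rw [← (Measure.measurePreserving_neg (volume : Measure ℝ)).setLIntegral_comp_preimage_emb
      (MeasurableEquiv.neg ℝ).measurableEmbedding f S]
    simp only [hf]
  calc _ ≤ ∫⁻ x in S ∪ (fun x => -x) ⁻¹' S, f x := lintegral_mono_set hsub
    _ ≤ _ := lintegral_union_le _ _ _
    _ = _ := by rw [hneg, two_mul]

lemma setLIntegral_inv_sq_le {c : ℝ} (hc : 0 < c) :
    ∫⁻ x in {x : ℝ | c ≤ |x|}, ENNReal.ofReal ((x ^ 2)⁻¹) ≤ ENNReal.ofReal (2 / c) := by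
  have key : ∫⁻ x in Set.Ici c, ENNReal.ofReal ((x ^ 2)⁻¹) = ENNReal.ofReal (1 / c) := by
    rw [setLIntegral_congr Ioi_ae_eq_Ici.symm]
    have hcongr : ∀ x ∈ Set.Ioi c, x ^ (-2 : ℝ) = (x ^ 2)⁻¹ := fun x hx => by
      rw [Real.rpow_neg (hc.trans hx).le]; norm_cast
    have hint : IntegrableOn (fun x : ℝ => (x ^ 2)⁻¹) (Set.Ioi c) :=
      (integrableOn_Ioi_rpow_of_lt (by norm_num : (-2 : ℝ) < -1) hc).congr_fun hcongr
        measurableSet_Ioi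
    rw [← ofReal_integral_eq_lintegral_ofReal hint (Filter.Eventually.of_forall fun x => by
      positivity), ← setIntegral_congr_fun measurableSet_Ioi hcongr,
      integral_Ioi_rpow_of_lt (by norm_num) hc]
    norm_num [Real.rpow_neg_one]
  refine (setLIntegral_abs_mem_le_of_even (by simp) (Set.Ici c)).trans ?_
  rw [key, ← ENNReal.ofReal_ofNat 2, ← ENNReal.ofReal_mul (by norm_num), mul_one_div]

lemma setLIntegral_abs_inv_le {a : ℝ} (ha : 0 < a) (R : ℝ) :
    ∫⁻ x in {x : ℝ | |x| ∈ Set.Icc a R}, ENNReal.ofReal |x|⁻¹ ≤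
      2 * ENNReal.ofReal (Real.log (R / a)) := by
  refine (setLIntegral_abs_mem_le_of_even (by simp) (Set.Icc a R)).trans ?_
  gcongr
  rcases lt_or_ge R a with h | h
  · simp [Set.Icc_eq_empty h.not_ge]
  rw [setLIntegral_congr Ioc_ae_eq_Icc.symm, ← integral_inv_of_pos ha (ha.trans_le h),
    intervalIntegral.integral_of_le h]
  have hint : IntegrableOn (fun x : ℝ => x⁻¹) (Set.Ioc a R) :=
    (intervalIntegrable_iff_integrableOn_Ioc_of_le h).1
      (intervalIntegral.intervalIntegrable_inv (fun x hx => by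
        rw [Set.uIcc_of_le h] at hx; exact (ha.trans_le hx.1).ne') continuousOn_id)
  rw [ofReal_integral_eq_lintegral_ofReal hint]
  · exact (setLIntegral_congr_fun measurableSet_Ioc fun x hx => by
      simp only [abs_of_pos (ha.trans hx.1)]).le
  · exact (ae_restrict_iff' measurableSet_Ioc).2
      (Filter.Eventually.of_forall fun x hx => (inv_pos.2 (ha.trans hx.1)).le)

lemma lintegral_fin_succ {n : ℕ} {f : (Fin (n + 1) → ℝ) → ENNReal} (hf : Measurable f) :
    ∫⁻ l, f l = ∫⁻ y : Fin n → ℝ, ∫⁻ x : ℝ, f (Fin.cons x y) := by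
  have e := (volume_preserving_piFinSuccAbove (fun _ : Fin (n + 1) => ℝ) 0).symm
  rw [← e.lintegral_comp_emb (MeasurableEquiv.measurableEmbedding _)]
  refine (lintegral_prod_symm' _ (hf.comp e.measurable)).trans ?_
  simp [MeasurableEquiv.piFinSuccAbove_symm_apply, Fin.insertNthEquiv]

lemma lintegral_prod_fin_eq_pow {f : ℝ → ENNReal} (hf : Measurable f) (n : ℕ) :
    ∫⁻ l : Fin n → ℝ, ∏ i, f (l i) = (∫⁻ x, f x) ^ n := by
  induction n with
  | zero => simp [volume_pi]
  | succ n ih =>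
    rw [lintegral_fin_succ (by fun_prop)]
    simp only [Fin.prod_univ_succ, Fin.cons_zero, Fin.cons_succ]
    simp_rw [lintegral_mul_const _ hf]
    rw [lintegral_const_mul _ (by fun_prop), ih, pow_succ']

/-- The integral of `1/(l₁²⋯l_d²)` over the points with coordinates in a given annulus and with
product bounded below. -/
lemma setLIntegral_inv_prod_sq_le (n : ℕ) {a δ : ℝ} (ha : 0 < a) (hδ : 0 < δ) (R : ℝ) :
    ∫⁻ l in {l : Fin (n + 1) → ℝ | (∀ i, |l i| ∈ Set.Icc a R) ∧ δ ≤ |∏ i, l i|},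
        ENNReal.ofReal ((∏ i, l i ^ 2)⁻¹) ≤
      ENNReal.ofReal (2 / δ) * (2 * ENNReal.ofReal (Real.log (R / a))) ^ n := by
  set S : Set ℝ := {x | |x| ∈ Set.Icc a R}
  have hSm : MeasurableSet S := measurableSet_Icc.preimage measurable_norm
  set q : ℝ → ENNReal := fun x => ENNReal.ofReal ((x ^ 2)⁻¹) with hq
  have hqm : Measurable q := by fun_prop
  set w : ℝ → ENNReal := S.indicator fun x => ENNReal.ofReal |x|⁻¹ with hw
  have hwm : Measurable w := Measurable.indicator (by fun_prop) hSm
  have hqS : Measurable (S.indicator q) := hqm.indicator hSm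
  set T : Set (Fin (n + 1) → ℝ) := {l | δ ≤ |∏ i, l i|} with hT
  have hTm : MeasurableSet T := measurableSet_le measurable_const (by fun_prop)
  set G : (Fin (n + 1) → ℝ) → ENNReal := fun l =>
    T.indicator (fun l => q (l 0)) l * ∏ i : Fin n, S.indicator q (l i.succ) with hG
  have hGm : Measurable G :=
    (Measurable.indicator (by fun_prop) hTm).mul
      (Finset.measurable_fun_prod _ fun i _ => hqS.comp (measurable_pi_apply _))
  have hbound : ∀ y : Fin n → ℝ, ∫⁻ x : ℝ, G (Fin.cons x y) ≤
      ENNReal.ofReal (2 / δ) * ∏ i, w (y i) := by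
    intro y
    simp only [hG, Fin.cons_succ]
    by_cases hy : ∀ i, y i ∈ S
    · have hpos : ∀ i, 0 < |y i| := fun i => ha.trans_le (hy i).1
      have hP : 0 < ∏ i, |y i| := Finset.prod_pos fun i _ => hpos i
      have hm : Measurable fun x : ℝ =>
          T.indicator (fun l => q (l 0)) (Fin.cons x y : Fin (n + 1) → ℝ) := by
        have hcons : Measurable fun x : ℝ => (Fin.cons x y : Fin (n + 1) → ℝ) :=
          measurable_pi_iff.2 fun i => by
            refine Fin.cases ?_ (fun j => ?_) i
            · simpa using measurable_id'
            · simp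
        exact (Measurable.indicator (by fun_prop) hTm).comp hcons
      rw [lintegral_mul_const _ hm]
      have hint : ∫⁻ x : ℝ, T.indicator (fun l => q (l 0)) (Fin.cons x y : Fin (n + 1) → ℝ) ≤
          ENNReal.ofReal (2 / (δ / ∏ i, |y i|)) := by
        refine le_trans (le_of_eq ?_) (setLIntegral_inv_sq_le (div_pos hδ hP))
        rw [← lintegral_indicator (measurableSet_le measurable_const (by fun_prop))]
        refine lintegral_congr fun x => ?_
        simp only [Set.indicator_apply, hT, Set.mem_ofPred_eq, Fin.prod_univ_succ, Fin.cons_zero,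
          Fin.cons_succ, abs_mul, Finset.abs_prod, div_le_iff₀ hP, hq]
      refine (mul_le_mul_left hint _).trans (le_of_eq ?_)
      have h1 : ∏ i, S.indicator q (y i) = ENNReal.ofReal (∏ i, (y i ^ 2)⁻¹) := by
        rw [ENNReal.ofReal_prod_of_nonneg fun i _ => by positivity]
        exact Finset.prod_congr rfl fun i _ => Set.indicator_of_mem (hy i) _
      have h2 : ∏ i, w (y i) = ENNReal.ofReal (∏ i, |y i|⁻¹) := by
        rw [ENNReal.ofReal_prod_of_nonneg fun i _ => by positivity]
        exact Finset.prod_congr rfl fun i _ => Set.indicator_of_mem (hy i) _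
      rw [h1, h2, ← ENNReal.ofReal_mul (by positivity), ← ENNReal.ofReal_mul (by positivity)]
      congr 1
      simp only [← sq_abs (y _), Finset.prod_inv_distrib, Finset.prod_pow]
      field_simp
    · push Not at hy
      obtain ⟨i, hi⟩ := hy
      have h0 : ∏ i, S.indicator q (y i) = 0 :=
        Finset.prod_eq_zero (Finset.mem_univ i) (Set.indicator_of_notMem hi _)
      simp [h0]
  calc _ ≤ ∫⁻ l in {l : Fin (n + 1) → ℝ | (∀ i, |l i| ∈ Set.Icc a R) ∧ δ ≤ |∏ i, l i|}, G l := by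
        refine setLIntegral_mono hGm fun l hl => le_of_eq ?_
        have hl0 : T.indicator (fun l => q (l 0)) l = q (l 0) :=
          Set.indicator_of_mem (s := T) hl.2 _
        have hls : ∀ i : Fin n, S.indicator q (l i.succ) = q (l i.succ) := fun i =>
          Set.indicator_of_mem (s := S) (hl.1 i.succ) _
        simp only [hG, hl0, hls]
        rw [← Finset.prod_inv_distrib, ENNReal.ofReal_prod_of_nonneg fun i _ => by positivity,
          Fin.prod_univ_succ]
    _ ≤ ∫⁻ l, G l := setLIntegral_le_lintegral _ _
    _ = ∫⁻ y : Fin n → ℝ, ∫⁻ x : ℝ, G (Fin.cons x y) := lintegral_fin_succ hGm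
    _ ≤ ∫⁻ y : Fin n → ℝ, ENNReal.ofReal (2 / δ) * ∏ i, w (y i) := lintegral_mono hbound
    _ = ENNReal.ofReal (2 / δ) * (∫⁻ x, w x) ^ n := by
        rw [lintegral_const_mul _ (by fun_prop), lintegral_prod_fin_eq_pow hwm]
    _ ≤ _ := by
        gcongr
        rw [hw, lintegral_indicator hSm]
        exact setLIntegral_abs_inv_le ha R

/-- A lower bound on a product and an upper bound on each factor bound each factor from below. -/
lemma div_pow_le_abs_of_le_abs_prod_s13 {n : ℕ} {δ R : ℝ} (hR : 0 < R) {l : Fin (n + 1) → ℝ}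
    (hl : ∀ i, |l i| ≤ R) (hδ : δ ≤ |∏ i, l i|) (i : Fin (n + 1)) : δ / R ^ n ≤ |l i| := by
  rw [div_le_iff₀ (by positivity)]
  refine hδ.trans ?_
  rw [Fin.prod_univ_succAbove _ i, abs_mul, Finset.abs_prod]
  gcongr
  refine (Finset.prod_le_prod (fun _ _ => abs_nonneg _) fun j _ => hl (i.succAbove j)).trans ?_
  simp

/-- For `d ≥ 2` and every `ε₁ > 0` there is `M > 0` such that for every `ε > 0` there is
`t₀ > 0` such that for all `t ≥ t₀`, the integral of `1/(l₁²⋯l_d²)` over the region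
`{l ∈ ℝ^d : 1 ≤ ‖l‖ ≤ t^{1+ε₁}, |l₁⋯l_d| ≥ 1/(ε·(log t)^{d−1})}` is at most
`M·(log t)^{2d−2}·ε`. -/
theorem stmt13 (d : ℕ) (hd : 2 ≤ d) (ε₁ : ℝ) (hε₁ : 0 < ε₁) :
    ∃ M > (0 : ℝ), ∀ ε > (0 : ℝ), ∃ t₀ > (0 : ℝ), ∀ t : ℝ, t₀ ≤ t →
      (∫⁻ l in {l : EuclideanSpace ℝ (Fin d) |
            1 ≤ ‖l‖ ∧ ‖l‖ ≤ t ^ ((1 : ℝ) + ε₁) ∧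
            (ε * Real.log t ^ (d - 1))⁻¹ ≤ |∏ i, l i|},
          ENNReal.ofReal ((∏ i, (l i) ^ 2)⁻¹))
        ≤ ENNReal.ofReal (M * Real.log t ^ (2 * d - 2) * ε) := by
  obtain ⟨n, rfl⟩ : ∃ n, d = n + 1 := ⟨d - 1, by omega⟩
  rw [show n + 1 - 1 = n by omega, show 2 * (n + 1) - 2 = n + n by omega]
  set K : ℝ := (n + 1) * (1 + ε₁) + 1 + n with hK
  have hKpos : 0 < K := by positivity
  refine ⟨2 * (2 * K) ^ n, by positivity, fun ε hε =>
    ⟨max (Real.exp 1) ε, lt_max_of_lt_right hε, fun t ht => ?_⟩⟩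
  have htpos : 0 < t := hε.trans_le ((le_max_right _ _).trans ht)
  set L := Real.log t with hL
  have hL1 : 1 ≤ L := (Real.le_log_iff_exp_le htpos).2 ((le_max_left _ _).trans ht)
  have hLpos : 0 < L := one_pos.trans_le hL1
  have hεL : Real.log ε ≤ L := Real.log_le_log hε ((le_max_right _ _).trans ht)
  have hLL : Real.log L ≤ L := Real.log_le_self hLpos.le
  set R := t ^ (1 + ε₁) with hR
  have hRpos : 0 < R := Real.rpow_pos_of_pos htpos _
  have hRlog : Real.log R = (1 + ε₁) * L := Real.log_rpow htpos _
  set δ := (ε * L ^ n)⁻¹ with hδ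
  have hδpos : 0 < δ := by positivity
  have hapos : 0 < δ / R ^ n := by positivity
  have hlog : Real.log (R / (δ / R ^ n)) ≤ K * L := by
    rw [Real.log_div hRpos.ne' hapos.ne', Real.log_div hδpos.ne' (by positivity), Real.log_pow,
      hδ, Real.log_inv, Real.log_mul hε.ne' (by positivity), Real.log_pow, hRlog, hK]
    nlinarith [mul_le_mul_of_nonneg_left hLL (Nat.cast_nonneg (α := ℝ) n)]
  calc _ ≤ ∫⁻ l in (WithLp.ofLp : EuclideanSpace ℝ (Fin (n + 1)) → _) ⁻¹'
          {l : Fin (n + 1) → ℝ | (∀ i, |l i| ∈ Set.Icc (δ / R ^ n) R) ∧ δ ≤ |∏ i, l i|},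
          ENNReal.ofReal ((∏ i, (l i) ^ 2)⁻¹) := by
        refine lintegral_mono_set fun l hl => ?_
        have hle : ∀ i, |l i| ≤ R := fun i => (PiLp.norm_apply_le l i).trans hl.2.1
        exact ⟨fun i => ⟨div_pow_le_abs_of_le_abs_prod_s13 hRpos hle hl.2.2 i, hle i⟩, hl.2.2⟩
    _ = ∫⁻ l in {l : Fin (n + 1) → ℝ | (∀ i, |l i| ∈ Set.Icc (δ / R ^ n) R) ∧ δ ≤ |∏ i, l i|},
          ENNReal.ofReal ((∏ i, (l i) ^ 2)⁻¹) :=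
        (PiLp.volume_preserving_ofLp (Fin (n + 1))).setLIntegral_comp_preimage_emb
          (MeasurableEquiv.toLp 2 _).symm.measurableEmbedding
          (fun l => ENNReal.ofReal ((∏ i, (l i) ^ 2)⁻¹)) _
    _ ≤ ENNReal.ofReal (2 / δ) * (2 * ENNReal.ofReal (Real.log (R / (δ / R ^ n)))) ^ n :=
        setLIntegral_inv_prod_sq_le n hapos hδpos R
    _ ≤ ENNReal.ofReal (2 / δ) * (2 * ENNReal.ofReal (K * L)) ^ n := by gcongr
    _ = _ := by
        rw [show (2 : ENNReal) = ENNReal.ofReal 2 by simp, ← ENNReal.ofReal_mul (by norm_num),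
          ← ENNReal.ofReal_pow (by positivity), ← ENNReal.ofReal_mul (by positivity)]
        congr 1
        rw [hδ, div_inv_eq_mul, pow_add, ← mul_assoc 2 K L, mul_pow (2 * K)]
        ring
end
end
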